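/- Let f : ℝⁿ → ℝ be real analytic and let p be a local minimum of f. Then p has a neighborhood U and there exist β ∈ (0,1) and C > 0 such that every gradient flow γ : [0,∞) → ℝⁿ of f with γ(0) ∈ U converges as t → ∞, and moreover the arclength of γ on [t,∞) satisfies ∫_t^∞ ‖γ'(ζ)‖ dζ ≤ C |f(γ(t)) − f(p)|^β for all t ≥ 0. -/

import Mathlib

open Filter MeasureTheory

section

open Topology

namespace GF

/-- germs of analytic functions form a domain -/
lemma mul_zero_germ {E : Type*} [NormedAddCommGroup E] [NormedSpace ℝ E] {f g : E → ℝ} {a : E}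
    (hf : AnalyticAt ℝ f a) (hg : AnalyticAt ℝ g a) (h : ∀ᶠ x in 𝓝 a, f x * g x = 0) :
    (∀ᶠ x in 𝓝 a, f x = 0) ∨ (∀ᶠ x in 𝓝 a, g x = 0) := by
  obtain ⟨r, hr, hB⟩ := Metric.eventually_nhds_iff_ball.1
    (hf.eventually_analyticAt.and (hg.eventually_analyticAt.and h))
  by_cases hx : ∃ x ∈ Metric.ball a r, f x ≠ 0
  · right
    obtain ⟨x, hx, hfx⟩ := hx
    have hgB : AnalyticOnNhd ℝ g (Metric.ball a r) := fun y hy => (hB y hy).2.1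
    have hev : g =ᶠ[𝓝 x] 0 := by
      have h1 : ∀ᶠ y in 𝓝 x, f y ≠ 0 :=
        (hB x hx).1.continuousAt.eventually_ne hfx
      filter_upwards [h1, Metric.isOpen_ball.mem_nhds hx] with y h1 h2
      have := (hB y h2).2.2
      simpa [h1] using this
    have := hgB.eqOn_zero_of_preconnected_of_eventuallyEq_zero
      (convex_ball a r).isPreconnected hx hev
    filter_upwards [Metric.ball_mem_nhds a hr] with y hy using this hy
  · left
    push Not at hx
    filter_upwards [Metric.ball_mem_nhds a hr] with y hy using hx y hy

lemma prod_zero_germ {E : Type*} [NormedAddCommGroup E] [NormedSpace ℝ E] {ι : Type*}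
    (s : Finset ι) {f : ι → E → ℝ} {a : E}
    (hf : ∀ i ∈ s, AnalyticAt ℝ (f i) a) (h : ∀ i ∈ s, ¬ ∀ᶠ x in 𝓝 a, f i x = 0) :
    ¬ ∀ᶠ x in 𝓝 a, ∏ i ∈ s, f i x = 0 := by
  classical
  induction s using Finset.induction_on with
  | empty => simpa using (inferInstance : (𝓝 a).NeBot).ne
  | insert j s hj ih =>
    intro hh
    simp only [Finset.prod_insert hj] at hh
    rcases mul_zero_germ (hf j (by simp))
      (Finset.analyticAt_fun_prod s (fun i hi => hf i (by simp [hi]))) hh with h1 | h1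
    · exact h j (by simp) h1
    · exact ih (fun i hi => hf i (by simp [hi])) (fun i hi => h i (by simp [hi])) h1

section division
variable {E : Type*} [NormedAddCommGroup E] [NormedSpace ℝ E]

/-- building block of the quotient series -/
noncomputable def qs (p : FormalMultilinearSeries ℝ E ℝ) (e : E) (π : E →L[ℝ] E) :
    FormalMultilinearSeries ℝ E ℝ := fun n =>
  ∑ i : Fin (n + 1), ((p (n + 1)).compContinuousLinearMap
    (fun j => if j ≤ i then ContinuousLinearMap.id ℝ E else π)).curryMid i e

lemma qs_norm (p : FormalMultilinearSeries ℝ E ℝ) (e : E) (π : E →L[ℝ] E) (n : ℕ) :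
    ‖qs p e π n‖ ≤ (n + 1) * (‖p (n + 1)‖ * (max 1 ‖π‖) ^ (n + 1) * ‖e‖) := by
  unfold qs
  refine (norm_sum_le _ _).trans ?_
  have : ∀ i ∈ (Finset.univ : Finset (Fin (n + 1))), ‖((p (n + 1)).compContinuousLinearMap
    (fun j => if j ≤ i then ContinuousLinearMap.id ℝ E else π)).curryMid i e‖ ≤
      ‖p (n + 1)‖ * (max 1 ‖π‖) ^ (n + 1) * ‖e‖ := by
    intro i _
    refine (ContinuousLinearMap.le_opNorm _ _).trans ?_
    rw [ContinuousMultilinearMap.norm_curryMid]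
    gcongr
    refine (ContinuousMultilinearMap.norm_compContinuousLinearMap_le _ _).trans ?_
    gcongr
    calc _ ≤ ∏ j : Fin (n + 1), max 1 ‖π‖ := by
          apply Finset.prod_le_prod
          · intros; positivity
          · intro j _
            split_ifs
            · exact ContinuousLinearMap.norm_id_le.trans (le_max_left _ _)
            · exact le_max_right _ _
      _ = _ := by simp
  refine (Finset.sum_le_card_nsmul _ _ _ this).trans ?_
  simp

lemma qs_apply (p : FormalMultilinearSeries ℝ E ℝ) (e : E) (π : E →L[ℝ] E) (l : E →L[ℝ] ℝ)
    (hπ : ∀ y, y - π y = l y • e) (n : ℕ) (y : E) :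
    p (n + 1) (fun _ => y) - p (n + 1) (fun _ => π y) = l y * qs p e π n (fun _ => y) := by
  set T : ℕ → ℝ := fun i => p (n + 1) (fun j => if (j : ℕ) < i then y else π y) with hT
  have h0 : p (n + 1) (fun _ => y) = T (n + 1) := by
    simp only [hT]; congr 1; ext j; rw [if_pos j.2]
  have h1 : p (n + 1) (fun _ => π y) = T 0 := by
    simp only [hT]; congr 1
  rw [h0, h1, ← Finset.sum_range_sub T (n + 1), ← Fin.sum_univ_eq_sum_range
    (fun i => T (i + 1) - T i)]
  simp only [qs, sum_apply, Finset.mul_sum]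
  refine Finset.sum_congr rfl fun i _ => ?_
  rw [ContinuousMultilinearMap.curryMid_apply]
  have e1 : T ((i : ℕ) + 1) = p (n + 1) (Function.update
      (fun j : Fin (n + 1) => if (j : ℕ) < i then y else π y) i y) := by
    simp only [hT]; congr 1; ext j
    by_cases hj : j = i
    · subst hj; simp
    · have : (j : ℕ) ≠ i := fun h => hj (Fin.ext h)
      rw [Function.update_of_ne hj]
      have : (j : ℕ) < i + 1 ↔ (j : ℕ) < i := by omega
      simp [this]
  have e2 : T (i : ℕ) = p (n + 1) (Function.update
      (fun j : Fin (n + 1) => if (j : ℕ) < i then y else π y) i (π y)) := by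
    simp only [hT]; congr 1; ext j
    by_cases hj : j = i
    · subst hj; simp
    · rw [Function.update_of_ne hj]
  rw [e1, e2, ← ContinuousMultilinearMap.map_update_sub, hπ, ContinuousMultilinearMap.map_update_smul,
    smul_eq_mul]
  congr 1
  rw [ContinuousMultilinearMap.compContinuousLinearMap_apply]
  congr 1
  ext j
  by_cases hj : j = i
  · subst hj; simp
  · rw [Function.update_of_ne hj]
    have h3 : (i.insertNth e (fun _ : Fin n => y) : Fin (n + 1) → E) j = y := by
      obtain ⟨k, rfl⟩ := Fin.exists_succAbove_eq hj
      simp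
    rw [h3]
    have hne : (j : ℕ) ≠ i := fun h => hj (Fin.ext h)
    by_cases hlt : (j : ℕ) < i
    · have : j ≤ i := by rw [Fin.le_def]; omega
      simp [this, hlt]
    · have : ¬ j ≤ i := by rw [Fin.le_def]; omega
      simp [this, hlt]

/-- division lemma -/
lemma division {f : E → ℝ} {a : E} (hf : AnalyticAt ℝ f a) (e : E) (l : E →L[ℝ] ℝ) :
    ∃ h : E → ℝ, AnalyticAt ℝ h a ∧
      ∀ᶠ x in 𝓝 a, f x = f (x - l (x - a) • e) + l (x - a) * h x := by
  obtain ⟨p, r, hp⟩ := hf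
  set π : E →L[ℝ] E := ContinuousLinearMap.id ℝ E - l.smulRight e with hπd
  have hπ : ∀ y, y - π y = l y • e := by intro y; simp [hπd]
  set q := qs p e π with hq
  have hqr : 0 < q.radius := by
    obtain ⟨ρ, hρ, hρ'⟩ := ENNReal.lt_iff_exists_nnreal_btwn.1 (lt_of_lt_of_le hp.r_pos hp.r_le)
    have hρ0 : 0 < (ρ : ℝ) := by exact_mod_cast hρ
    obtain ⟨C, hC, hCb⟩ := p.norm_mul_pow_le_of_lt_radius hρ'
    set M := max 1 ‖π‖ with hM
    have hM1 : 1 ≤ M := le_max_left _ _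
    -- radius s = ρ / (2 M)
    obtain ⟨s, hs⟩ : ∃ s : NNReal, (s : ℝ) = (ρ : ℝ) / (2 * M) :=
      ⟨⟨(ρ : ℝ) / (2 * M), by positivity⟩, rfl⟩
    have hs0 : 0 < (s : ENNReal) := by
      have : (0 : ℝ) < (s : ℝ) := by rw [hs]; positivity
      exact_mod_cast this
    refine lt_of_lt_of_le hs0 ?_
    refine q.le_radius_of_bound (C * M / ρ * ‖e‖ * 1) fun n => ?_
    have h1 := qs_norm p e π n
    have h2 := hCb (n + 1)
    have hsn : ((s : ℝ)) ^ n = (ρ : ℝ) ^ n / (2 ^ n * M ^ n) := by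
      rw [hs, div_pow, mul_pow]
    have hn : ((n : ℝ) + 1) / 2 ^ n ≤ 1 := by
      rw [div_le_one (by positivity)]
      have : n + 1 ≤ 2 ^ n := Nat.lt_two_pow_self
      exact_mod_cast this
    calc ‖q n‖ * (s : ℝ) ^ n
        ≤ ((n + 1) * (‖p (n + 1)‖ * M ^ (n + 1) * ‖e‖)) * ((ρ : ℝ) ^ n / (2 ^ n * M ^ n)) := by
          rw [hsn]; gcongr
      _ = (‖p (n + 1)‖ * ρ ^ (n + 1)) * M / ρ * ‖e‖ * (((n : ℝ) + 1) / 2 ^ n) := by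
          field_simp
          ring
      _ ≤ C * M / ρ * ‖e‖ * 1 := by gcongr
  have hqs := (q.hasFPowerSeriesOnBall hqr)
  refine ⟨fun x => q.sum (x - a), ⟨q, ?_⟩, ?_⟩
  · have := hqs.hasFPowerSeriesAt.comp_sub a
    simpa using this
  have t1 : Tendsto (fun x => x - a) (𝓝 a) (𝓝 0) := by
    have : Continuous (fun x : E => x - a) := by fun_prop
    simpa using this.tendsto a
  have t2 : Tendsto (fun x => π (x - a)) (𝓝 a) (𝓝 0) := by
    have : Continuous (fun x : E => π (x - a)) := by fun_prop
    simpa using this.tendsto a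
  have b1 : ∀ᶠ x in 𝓝 (0:E), x ∈ Metric.eball (0:E) r := Metric.eball_mem_nhds _ hp.r_pos
  have b2 : ∀ᶠ x in 𝓝 (0:E), x ∈ Metric.eball (0:E) q.radius := Metric.eball_mem_nhds _ hqr
  filter_upwards [t1.eventually b1, t2.eventually b1, t1.eventually b2] with x h1 h2 h3
  set y := x - a with hy
  have s1 := hp.hasSum h1
  have s2 := hp.hasSum h2
  have s3 := (hqs.hasSum h3).mul_left (l y)
  simp only [zero_add] at s3
  have s4 := (hasSum_nat_add_iff' 1).2 (s1.sub s2)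
  have hz : ∑ i ∈ Finset.range 1, ((p i fun _ => y) - p i fun _ => π y) = 0 := by
    simp only [Finset.range_one, Finset.sum_singleton, sub_eq_zero]
    congr 1; ext i; exact i.elim0
  rw [hz, sub_zero] at s4
  have := s4.unique (by simpa only [qs_apply p e π l hπ] using s3)
  have e1 : a + y = x := by simp [hy]
  have e2 : a + π y = x - l y • e := by rw [← hπ, hy]; abel
  rw [e1, e2] at this
  linarith

end division
end GF

namespace GF

/-- normal crossings at `b` -/
def NC {n : ℕ} (f : (Fin n → ℝ) → ℝ) (b : Fin n → ℝ) : Prop :=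
  ∃ (α : Fin n → ℕ) (u : (Fin n → ℝ) → ℝ), AnalyticAt ℝ u b ∧ u b ≠ 0 ∧
    ∀ᶠ x in 𝓝 b, f x = (∏ i, (x i - b i) ^ α i) * u x

section
variable {n : ℕ} {f g : (Fin n → ℝ) → ℝ} {b : Fin n → ℝ}

lemma analyticAt_coord (i : Fin n) (b : Fin n → ℝ) :
    AnalyticAt ℝ (fun x : Fin n → ℝ => x i) b :=
  (ContinuousLinearMap.proj (R := ℝ) (φ := fun _ : Fin n => ℝ) i).analyticAt b

lemma analyticAt_mono (α : Fin n → ℕ) (c b : Fin n → ℝ) :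
    AnalyticAt ℝ (fun x : Fin n → ℝ => ∏ i, (x i - c i) ^ α i) b :=
  Finset.analyticAt_fun_prod _ fun i _ => ((analyticAt_coord i b).sub analyticAt_const).pow _

lemma NC.congr (hf : NC f b) (h : ∀ᶠ x in 𝓝 b, g x = f x) : NC g b := by
  obtain ⟨α, u, hu, hu0, he⟩ := hf
  exact ⟨α, u, hu, hu0, by filter_upwards [he, h] with x h1 h2; rw [h2, h1]⟩

lemma NC.unit (hu : AnalyticAt ℝ f b) (h0 : f b ≠ 0) : NC f b :=
  ⟨fun _ => 0, f, hu, h0, by simp⟩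

lemma NC.analyticAt (hf : NC f b) : AnalyticAt ℝ f b := by
  obtain ⟨α, u, hu, hu0, he⟩ := hf
  have : (fun x => (∏ i, (x i - b i) ^ α i) * u x) =ᶠ[𝓝 b] f := by
    filter_upwards [he] with x hx using hx.symm
  exact ((analyticAt_mono α b b).mul hu).congr this

lemma NC.mul (hf : NC f b) (hg : NC g b) : NC (fun x => f x * g x) b := by
  obtain ⟨α, u, hu, hu0, he⟩ := hf
  obtain ⟨β, v, hv, hv0, he'⟩ := hg
  refine ⟨fun i => α i + β i, fun x => u x * v x, hu.mul hv, mul_ne_zero hu0 hv0, ?_⟩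
  filter_upwards [he, he'] with x h1 h2
  simp only [h1, h2, pow_add, Finset.prod_mul_distrib]; ring

lemma NC.pow (hf : NC f b) (k : ℕ) : NC (fun x => f x ^ k) b := by
  induction k with
  | zero => simpa using NC.unit (f := fun _ => (1:ℝ)) (b := b) analyticAt_const one_ne_zero
  | succ k ih => simpa only [pow_succ] using ih.mul hf

lemma NC.prod {ι : Type*} (s : Finset ι) {F : ι → (Fin n → ℝ) → ℝ} (h : ∀ i ∈ s, NC (F i) b) :
    NC (fun x => ∏ i ∈ s, F i x) b := by
  classical
  induction s using Finset.induction_on with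
  | empty => simpa using NC.unit (f := fun _ => (1:ℝ)) (b := b) analyticAt_const one_ne_zero
  | insert j s hj ih =>
    simp only [Finset.prod_insert hj]
    exact (h j (by simp)).mul (ih fun i hi => h i (by simp [hi]))

lemma NC.coord_sub (i : Fin n) (b : Fin n → ℝ) : NC (fun x => x i - b i) b :=
  ⟨fun j => if j = i then 1 else 0, fun _ => 1, analyticAt_const, one_ne_zero, by
    refine Eventually.of_forall fun x => ?_
    simp [Finset.prod_ite_eq']⟩

lemma NC.coord (i : Fin n) (b : Fin n → ℝ) : NC (fun x => x i) b := by
  by_cases h : b i = 0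
  · simpa [h] using NC.coord_sub i b
  · exact NC.unit (analyticAt_coord i b) h

lemma mono_germ (α : Fin n → ℕ) (b : Fin n → ℝ) :
    ¬ ∀ᶠ x in 𝓝 b, (∏ i, (x i - b i) ^ α i) = 0 := by
  refine prod_zero_germ _ (fun i _ => ((analyticAt_coord i b).sub analyticAt_const).pow _) ?_
  intro i _ h
  have h2 : Tendsto (fun t : ℝ => b + t • (1 : Fin n → ℝ)) (𝓝[≠] 0) (𝓝 b) := by
    have : Continuous (fun t : ℝ => b + t • (1 : Fin n → ℝ)) := by fun_prop
    have := this.tendsto 0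
    simp only [zero_smul, add_zero] at this
    exact this.mono_left nhdsWithin_le_nhds
  obtain ⟨t, ht, ht0⟩ := ((h2.eventually h).and self_mem_nhdsWithin).exists
  simp at ht
  exact ht0 ht.1

lemma NC.germ (hf : NC f b) : ¬ ∀ᶠ x in 𝓝 b, f x = 0 := by
  obtain ⟨α, u, hu, hu0, he⟩ := hf
  intro h
  have : ∀ᶠ x in 𝓝 b, (∏ i, (x i - b i) ^ α i) = 0 := by
    filter_upwards [he, h, hu.continuousAt.eventually_ne hu0] with x h1 h2 h3
    rw [h2] at h1
    simpa [h3] using h1.symm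
  exact mono_germ α b this

lemma prod_pow_split (α : Fin n → ℕ) (k : Fin n) (hk : 0 < α k) (y : Fin n → ℝ) :
    ∏ i, y i ^ α i = y k * ∏ i, y i ^ (Function.update α k (α k - 1) i) := by
  rw [← Finset.mul_prod_erase _ _ (Finset.mem_univ k),
    ← Finset.mul_prod_erase _ (fun i => y i ^ (Function.update α k (α k - 1) i))
      (Finset.mem_univ k), ← mul_assoc]
  congr 1
  · rw [Function.update_self, ← pow_succ']; congr 1; omega
  · refine Finset.prod_congr rfl fun i hi => ?_
    rw [Function.update_of_ne (Finset.ne_of_mem_erase hi)]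

/-- cancel an analytic factor -/
lemma cancel_germ {E : Type*} [NormedAddCommGroup E] [NormedSpace ℝ E] {m p q : E → ℝ} {b : E}
    (hm : AnalyticAt ℝ m b)
    (hp : AnalyticAt ℝ p b) (hq : AnalyticAt ℝ q b) (h0 : ¬ ∀ᶠ x in 𝓝 b, m x = 0)
    (h : ∀ᶠ x in 𝓝 b, m x * p x = m x * q x) : ∀ᶠ x in 𝓝 b, p x = q x := by
  rcases mul_zero_germ hm (hp.sub hq) (by
    filter_upwards [h] with x hx; simp [mul_sub, hx]) with h1 | h1
  · exact absurd h1 h0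
  · filter_upwards [h1] with x hx; simpa [sub_eq_zero] using hx

/-- divide by a coordinate -/
lemma coord_div (hf : AnalyticAt ℝ f b) (k : Fin n)
    (h : ∀ᶠ x in 𝓝 b, f (Function.update x k (b k)) = 0) :
    ∃ f' : (Fin n → ℝ) → ℝ, AnalyticAt ℝ f' b ∧ ∀ᶠ x in 𝓝 b, f x = (x k - b k) * f' x := by
  obtain ⟨f', hf', he⟩ := division hf (Pi.single k 1)
    (ContinuousLinearMap.proj (R := ℝ) (φ := fun _ : Fin n => ℝ) k)
  refine ⟨f', hf', ?_⟩
  filter_upwards [h, he] with x h1 h2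
  have : x - (x - b) k • (Pi.single k 1 : Fin n → ℝ) = Function.update x k (b k) := by
    ext j
    by_cases hj : j = k
    · subst hj; simp
    · simp [hj]
  simp only [ContinuousLinearMap.proj_apply] at h2
  rw [this, h1] at h2
  simpa using h2

lemma update_tendsto (b : Fin n → ℝ) (k : Fin n) :
    Tendsto (fun x : Fin n → ℝ => Function.update x k (b k)) (𝓝 b) (𝓝 b) := by
  have : Continuous (fun x : Fin n → ℝ => Function.update x k (b k)) := by fun_prop
  simpa using this.tendsto b

lemma update_analytic (b : Fin n → ℝ) (k : Fin n) (c : ℝ) :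
    AnalyticAt ℝ (fun x : Fin n → ℝ => Function.update x k c) b := by
  rw [analyticAt_pi_iff]
  intro i
  by_cases h : i = k
  · subst h; simpa using analyticAt_const
  · simpa [h] using analyticAt_coord i b

lemma NC.of_mul (hf : AnalyticAt ℝ f b) (hg : AnalyticAt ℝ g b)
    (h : NC (fun x => f x * g x) b) : NC f b := by
  obtain ⟨α, u, hu, hu0, he⟩ := h
  obtain ⟨m, hm⟩ : ∃ m, m = ∑ i, α i := ⟨_, rfl⟩
  induction m generalizing α f g with
  | zero =>
    have h0 : ∀ i, α i = 0 := by
      intro i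
      have := (Finset.sum_eq_zero_iff.1 hm.symm) i (by simp)
      exact this
    refine NC.unit hf fun hfb => hu0 ?_
    have := he.self_of_nhds
    simpa [h0, hfb] using this.symm
  | succ m ih =>
    obtain ⟨k, hk⟩ : ∃ k, 0 < α k := by
      by_contra hcon
      push Not at hcon
      have : ∑ i, α i = 0 := Finset.sum_eq_zero fun i _ => by have := hcon i; omega
      omega
    set α' := Function.update α k (α k - 1) with hα'
    have hsum : m = ∑ i, α' i := by
      rw [← Finset.add_sum_erase _ _ (Finset.mem_univ k)] at hm ⊢
      have : ∑ x ∈ Finset.univ.erase k, α' x = ∑ x ∈ Finset.univ.erase k, α x :=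
        Finset.sum_congr rfl fun i hi => by
          rw [hα', Function.update_of_ne (Finset.ne_of_mem_erase hi)]
      rw [this, hα', Function.update_self]
      omega
    have hsplit : ∀ x : Fin n → ℝ, ∏ i, (x i - b i) ^ α i =
        (x k - b k) * ∏ i, (x i - b i) ^ α' i := fun x =>
      prod_pow_split α k hk (fun i => x i - b i)
    have hz : ∀ᶠ x in 𝓝 b, f (Function.update x k (b k)) * g (Function.update x k (b k)) = 0 := by
      filter_upwards [(update_tendsto b k).eventually he] with x hx
      rw [hx, hsplit]; simp
    have hup : Function.update b k (b k) = b := by simp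
    have hf1 : AnalyticAt ℝ (fun x => f (Function.update x k (b k))) b :=
      AnalyticAt.fun_comp (by rwa [hup]) (update_analytic b k (b k))
    have hg1 : AnalyticAt ℝ (fun x => g (Function.update x k (b k))) b :=
      AnalyticAt.fun_comp (by rwa [hup]) (update_analytic b k (b k))
    have hck : AnalyticAt ℝ (fun x : Fin n → ℝ => x k - b k) b :=
      (analyticAt_coord k b).sub analyticAt_const
    have hcan : ∀ p : (Fin n → ℝ) → ℝ, AnalyticAt ℝ p b →
        (∀ᶠ x in 𝓝 b, (x k - b k) * p x = (∏ i, (x i - b i) ^ α i) * u x) →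
        ∀ᶠ x in 𝓝 b, p x = (∏ i, (x i - b i) ^ α' i) * u x := by
      intro p hp hpe
      refine cancel_germ hck hp ((analyticAt_mono α' b b).mul hu) (NC.coord_sub k b).germ ?_
      filter_upwards [hpe] with x hx
      rw [hx, hsplit]; simp [mul_assoc]
    rcases mul_zero_germ hf1 hg1 hz with h1 | h1
    · obtain ⟨f', hf', hfe⟩ := coord_div hf k h1
      have := ih hf' hg α' (hcan _ (hf'.mul hg) (by
        filter_upwards [he, hfe] with x h1 h2
        rw [← h1, h2]; simp [mul_assoc])) hsum
      exact ((NC.coord_sub k b).mul this).congr hfe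
    · obtain ⟨g', hg', hge⟩ := coord_div hg k h1
      exact ih hf hg' α' (hcan _ (hf.mul hg') (by
        filter_upwards [he, hge] with x h1 h2
        rw [← h1, h2]; ring)) hsum

lemma test_tendsto (b : Fin n → ℝ) (v : Fin n → ℝ) :
    Tendsto (fun t : ℝ => b + t • v) (𝓝[≠] 0) (𝓝 b) := by
  have : Continuous (fun t : ℝ => b + t • v) := by fun_prop
  have := this.tendsto 0
  simp only [zero_smul, add_zero] at this
  exact this.mono_left nhdsWithin_le_nhds

/-- monomials with normal crossings difference are comparable -/
lemma comparable {α β : Fin n → ℕ} {u v : (Fin n → ℝ) → ℝ}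
    (hu : AnalyticAt ℝ u b) (hu0 : u b ≠ 0) (hv : AnalyticAt ℝ v b) (hv0 : v b ≠ 0)
    (hf : ∀ᶠ x in 𝓝 b, f x = (∏ i, (x i - b i) ^ α i) * u x)
    (hg : ∀ᶠ x in 𝓝 b, g x = (∏ i, (x i - b i) ^ β i) * v x)
    (h : (∀ᶠ x in 𝓝 b, f x - g x = 0) ∨ NC (fun x => f x - g x) b) : α ≤ β ∨ β ≤ α := by
  by_contra hcon
  push Not at hcon
  obtain ⟨hab, hba⟩ := hcon
  simp only [Pi.le_def, not_forall, not_le] at hab hba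
  obtain ⟨j0, hj0⟩ := hab
  obtain ⟨i0, hi0⟩ := hba
  -- `β j0 < α j0`, `α i0 < β i0`
  set δ : Fin n → ℕ := fun i => min (α i) (β i) with hδ
  set A : (Fin n → ℝ) → ℝ := fun x => ∏ i, (x i - b i) ^ (α i - δ i) with hA
  set B : (Fin n → ℝ) → ℝ := fun x => ∏ i, (x i - b i) ^ (β i - δ i) with hB
  set X : (Fin n → ℝ) → ℝ := fun x => A x * u x - B x * v x with hX
  have hAan : AnalyticAt ℝ A b := analyticAt_mono _ b b
  have hBan : AnalyticAt ℝ B b := analyticAt_mono _ b b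
  have hXan : AnalyticAt ℝ X b := (hAan.mul hu).sub (hBan.mul hv)
  have hfac : ∀ᶠ x in 𝓝 b, f x - g x = X x * ∏ i, (x i - b i) ^ δ i := by
    filter_upwards [hf, hg] with x h1 h2
    have e1 : ∏ i, (x i - b i) ^ α i = A x * ∏ i, (x i - b i) ^ δ i := by
      rw [hA, ← Finset.prod_mul_distrib]
      refine Finset.prod_congr rfl fun i _ => ?_
      rw [← pow_add]; congr 1; simp only [hδ]; omega
    have e2 : ∏ i, (x i - b i) ^ β i = B x * ∏ i, (x i - b i) ^ δ i := by
      rw [hB, ← Finset.prod_mul_distrib]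
      refine Finset.prod_congr rfl fun i _ => ?_
      rw [← pow_add]; congr 1; simp only [hδ]; omega
    rw [h1, h2, e1, e2]; simp only [hX]; ring
  -- a test: for a vector `v` of zeros and ones
  have hun := hu.continuousAt.eventually_ne hu0
  have hvn := hv.continuousAt.eventually_ne hv0
  have test : ∀ (S : Finset (Fin n)), (∀ᶠ x in 𝓝 b, (∀ i ∈ S, x i - b i = 0) → X x = 0) →
      (∃ i ∈ S, 0 < α i - δ i) ∧ (∃ i ∈ S, 0 < β i - δ i) ∨
      (∀ i ∈ S, α i - δ i = 0) ∧ (∀ i ∈ S, β i - δ i = 0) := by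
    intro S hS
    set w : Fin n → ℝ := fun i => if i ∈ S then 0 else 1 with hw
    obtain ⟨t, ⟨ht1, ht2, ht3⟩, ht0⟩ := (((test_tendsto b w).eventually
      (hS.and (hun.and hvn))).and self_mem_nhdsWithin).exists
    have ht0 : t ≠ 0 := ht0
    have hx := ht1 (by intro i hi; simp [hw, hi])
    have hmono : ∀ γ : Fin n → ℕ, (∃ i ∈ S, 0 < γ i) ∧
        ∏ i, ((b + t • w) i - b i) ^ γ i = 0 ∨ (∀ i ∈ S, γ i = 0) ∧
        ∏ i, ((b + t • w) i - b i) ^ γ i ≠ 0 := by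
      intro γ
      by_cases hγ : ∃ i ∈ S, 0 < γ i
      · left
        refine ⟨hγ, ?_⟩
        obtain ⟨i, hi, hi'⟩ := hγ
        refine Finset.prod_eq_zero (Finset.mem_univ i) ?_
        simp [hw, hi]; omega
      · right
        push Not at hγ
        have hγ' : ∀ i ∈ S, γ i = 0 := fun i hi => by have := hγ i hi; omega
        refine ⟨hγ', ?_⟩
        rw [Finset.prod_ne_zero_iff]
        intro i _
        by_cases hi : i ∈ S
        · simp [hγ' i hi]
        · simp [hw, hi, ht0]
    simp only [hX, hA, hB] at hx
    rcases hmono (fun i => α i - δ i) with ⟨h1, h1'⟩ | ⟨h1, h1'⟩ <;>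
    rcases hmono (fun i => β i - δ i) with ⟨h2, h2'⟩ | ⟨h2, h2'⟩
    · exact Or.inl ⟨h1, h2⟩
    · rw [h1'] at hx
      exact absurd hx (by simp only [zero_mul, zero_sub, neg_ne_zero]; exact mul_ne_zero h2' ht3)
    · rw [h2'] at hx
      exact absurd hx (by simp only [zero_mul, sub_zero]; exact mul_ne_zero h1' ht2)
    · exact Or.inr ⟨h1, h2⟩
  have hd : ∀ i, α i - δ i = 0 ∨ β i - δ i = 0 := by intro i; simp only [hδ]; omega
  have hi0A : α i0 - δ i0 = 0 := by simp only [hδ]; omega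
  have hi0B : 0 < β i0 - δ i0 := by simp only [hδ]; omega
  have hj0A : 0 < α j0 - δ j0 := by simp only [hδ]; omega
  have hj0B : β j0 - δ j0 = 0 := by simp only [hδ]; omega
  rcases h with h | h
  · have hXz : ∀ᶠ x in 𝓝 b, X x = 0 := by
      have := mul_zero_germ hXan (analyticAt_mono δ b b) (by
        filter_upwards [h, hfac] with x h1 h2; rw [← h2, h1])
      rcases this with h | h
      · exact h
      · exact absurd h (mono_germ δ b)
    rcases test {i0} (by filter_upwards [hXz] with x hx _ using hx) with ⟨⟨i, hi, h1⟩, _⟩ | ⟨_, h2⟩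
    · simp only [Finset.mem_singleton] at hi; subst hi; omega
    · have := h2 i0 (by simp); omega
  · have hXnc : NC X b := NC.of_mul hXan (analyticAt_mono δ b b) (h.congr (by
      filter_upwards [hfac] with x hx using hx.symm))
    obtain ⟨γ, w, hw, hw0, hXe⟩ := hXnc
    have hXb : X b = 0 := by
      have hAb : A b = 0 := Finset.prod_eq_zero (Finset.mem_univ j0) (by simp; omega)
      have hBb : B b = 0 := Finset.prod_eq_zero (Finset.mem_univ i0) (by simp; omega)
      simp [hX, hAb, hBb]
    obtain ⟨k, hk⟩ : ∃ k, 0 < γ k := by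
      by_contra hcon
      push Not at hcon
      have h0 : ∀ k, γ k = 0 := fun k => by have := hcon k; omega
      have := hXe.self_of_nhds
      rw [hXb] at this
      simp [h0] at this
      exact hw0 this.symm
    have hXk : ∀ᶠ x in 𝓝 b, x k - b k = 0 → X x = 0 := by
      filter_upwards [hXe] with x hx hxk
      rw [hx, Finset.prod_eq_zero (Finset.mem_univ k) (by rw [hxk]; exact zero_pow (by omega)),
        zero_mul]
    -- `k` is in no support
    rcases test {k} (by filter_upwards [hXk] with x hx h; exact hx (h k (by simp))) with
      ⟨⟨i, hi, h1⟩, ⟨j, hj, h2⟩⟩ | ⟨h1, h2⟩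
    · simp only [Finset.mem_singleton] at hi hj; subst hi; subst hj
      rcases hd j with h | h <;> omega
    · have h1 := h1 k (by simp)
      rcases test {k, i0} (by filter_upwards [hXk] with x hx h; exact hx (h k (by simp))) with
        ⟨⟨i, hi, h3⟩, _⟩ | ⟨_, h4⟩
      · simp only [Finset.mem_insert, Finset.mem_singleton] at hi
        rcases hi with rfl | rfl <;> omega
      · have := h4 i0 (by simp); omega

end
end GF

namespace GF

/-- `f` can be monomialized near `a` by finitely many analytic charts, iterated -/
inductive Mz {n : ℕ} : ((Fin n → ℝ) → ℝ) → (Fin n → ℝ) → Prop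
  | nc {f : (Fin n → ℝ) → ℝ} {a : Fin n → ℝ} (h : NC f a) : Mz f a
  | cover {f : (Fin n → ℝ) → ℝ} {a : Fin n → ℝ} (ι : Type) (hι : Finite ι)
      (φ : ι → (Fin n → ℝ) → (Fin n → ℝ)) (K : ι → Set (Fin n → ℝ))
      (hK : ∀ i, IsCompact (K i)) (hc : ∀ i, ContinuousOn (φ i) (K i))
      (hcov : (⋃ i, φ i '' K i) ∈ 𝓝 a)
      (hA : ∀ i, ∀ b ∈ K i, φ i b = a → AnalyticAt ℝ (φ i) b)
      (hM : ∀ i, ∀ b ∈ K i, φ i b = a → Mz (f ∘ φ i) b) : Mz f a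

lemma Mz.congr {n : ℕ} {f : (Fin n → ℝ) → ℝ} {a : Fin n → ℝ} (h : Mz f a) :
    ∀ {g : (Fin n → ℝ) → ℝ}, (∀ᶠ x in 𝓝 a, g x = f x) → Mz g a := by
  induction h with
  | nc h => intro g hg; exact Mz.nc (h.congr hg)
  | cover ι hι φ K hK hc hcov hA hM ih =>
    intro g hg
    refine Mz.cover ι hι φ K hK hc hcov hA fun i b hb hba => ih i b hb hba ?_
    have := (hA i b hb hba).continuousAt.tendsto
    rw [hba] at this
    exact this.eventually hg

/-- one chart with a local right inverse -/
lemma Mz.chart {n : ℕ} {f : (Fin n → ℝ) → ℝ} {a : Fin n → ℝ}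
    (φ : (Fin n → ℝ) → (Fin n → ℝ)) (K : Set (Fin n → ℝ)) (hK : IsCompact K)
    (hc : ContinuousOn φ K) (hcov : φ '' K ∈ 𝓝 a)
    (hA : ∀ b ∈ K, φ b = a → AnalyticAt ℝ φ b)
    (hM : ∀ b ∈ K, φ b = a → Mz (f ∘ φ) b) : Mz f a :=
  Mz.cover Unit inferInstance (fun _ => φ) (fun _ => K) (fun _ => hK) (fun _ => hc)
    (by simpa [Set.iUnion_const] using hcov) (fun _ => hA) (fun _ => hM)

/-- cons -/
def cn {n : ℕ} (z : ℝ) (x : Fin n → ℝ) : Fin (n + 1) → ℝ := Fin.cons z x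
/-- tail -/
def tl {n : ℕ} (y : Fin (n + 1) → ℝ) : Fin n → ℝ := fun i => y i.succ

section
variable {n : ℕ}
@[simp] lemma cn_zero (z : ℝ) (x : Fin n → ℝ) : cn z x 0 = z := rfl
@[simp] lemma cn_succ (z : ℝ) (x : Fin n → ℝ) (i : Fin n) : cn z x i.succ = x i := rfl
@[simp] lemma tl_cn (z : ℝ) (x : Fin n → ℝ) : tl (cn z x) = x := rfl
@[simp] lemma tl_apply (y : Fin (n + 1) → ℝ) (i : Fin n) : tl y i = y i.succ := rfl
@[simp] lemma cn_tl (y : Fin (n + 1) → ℝ) : cn (y 0) (tl y) = y := by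
  ext i; refine Fin.cases ?_ (fun j => ?_) i <;> rfl

lemma cn_inj {z z' : ℝ} {x x' : Fin n → ℝ} (h : cn z x = cn z' x') : z = z' ∧ x = x' :=
  ⟨by simpa using congrFun h 0, by simpa using congrArg tl h⟩

lemma tl_analytic (y : Fin (n + 1) → ℝ) : AnalyticAt ℝ (tl (n := n)) y := by
  rw [analyticAt_pi_iff]; intro i; exact analyticAt_coord i.succ y

lemma tl_cont : Continuous (tl (n := n)) := by
  unfold tl; fun_prop

lemma cn_analytic {E : Type*} [NormedAddCommGroup E] [NormedSpace ℝ E] {p : E → ℝ}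
    {q : E → Fin n → ℝ} {e : E} (hp : AnalyticAt ℝ p e) (hq : AnalyticAt ℝ q e) :
    AnalyticAt ℝ (fun x => cn (p x) (q x)) e := by
  rw [analyticAt_pi_iff] at hq ⊢
  intro i
  refine Fin.cases ?_ (fun j => ?_) i
  · simpa using hp
  · simpa using hq j

lemma cn_contOn {E : Type*} [TopologicalSpace E] {p : E → ℝ}
    {q : E → Fin n → ℝ} {K : Set E} (hp : ContinuousOn p K) (hq : ContinuousOn q K) :
    ContinuousOn (fun x => cn (p x) (q x)) K := by
  rw [continuousOn_pi] at hq ⊢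
  intro i
  refine Fin.cases ?_ (fun j => ?_) i
  · simpa using hp
  · simpa using hq j

lemma cn_cont {E : Type*} [TopologicalSpace E] {p : E → ℝ}
    {q : E → Fin n → ℝ} (hp : Continuous p) (hq : Continuous q) :
    Continuous (fun x => cn (p x) (q x)) := by
  rw [← continuousOn_univ] at *
  exact cn_contOn hp hq

/-- transformation acting on the tail only -/
def lift (ψ : (Fin n → ℝ) → (Fin n → ℝ)) (y : Fin (n + 1) → ℝ) : Fin (n + 1) → ℝ :=
  cn (y 0) (ψ (tl y))

lemma lift_analytic {ψ : (Fin n → ℝ) → (Fin n → ℝ)} {y : Fin (n + 1) → ℝ}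
    (h : AnalyticAt ℝ ψ (tl y)) : AnalyticAt ℝ (lift ψ) y :=
  cn_analytic (analyticAt_coord 0 y) (h.fun_comp (tl_analytic y))

lemma compact_cyl {K : Set (Fin n → ℝ)} (hK : IsCompact K) (p q : ℝ) :
    IsCompact {y : Fin (n + 1) → ℝ | y 0 ∈ Set.Icc p q ∧ tl y ∈ K} := by
  have : {y : Fin (n + 1) → ℝ | y 0 ∈ Set.Icc p q ∧ tl y ∈ K} =
      (fun w : ℝ × (Fin n → ℝ) => cn w.1 w.2) '' (Set.Icc p q ×ˢ K) := by
    ext y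
    constructor
    · rintro ⟨h1, h2⟩; exact ⟨(y 0, tl y), ⟨h1, h2⟩, by simp⟩
    · rintro ⟨w, ⟨h1, h2⟩, rfl⟩; exact ⟨by simpa using h1, by simpa using h2⟩
  rw [this]
  exact (isCompact_Icc.prod hK).image (cn_cont continuous_fst continuous_snd)

lemma Mz.lift {h : (Fin n → ℝ) → ℝ} {a : Fin n → ℝ} (H : Mz h a) :
    ∀ (F : (Fin (n + 1) → ℝ) → ℝ) (s : ℝ),
      (∀ (ψ : (Fin n → ℝ) → (Fin n → ℝ)) (b : Fin n → ℝ), ψ b = a → AnalyticAt ℝ ψ b →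
        NC (h ∘ ψ) b → Mz (F ∘ GF.lift ψ) (cn s b)) → Mz F (cn s a) := by
  induction H with
  | nc hnc =>
    intro F s hF
    have := hF id _ rfl analyticAt_id hnc
    have e : F ∘ GF.lift (id : (Fin n → ℝ) → (Fin n → ℝ)) = F := by
      ext y; simp [GF.lift]
    rwa [e] at this
  | @cover h a ι hι φ K hK hc hcov hA hM ih =>
    intro F s hF
    have key : ∀ i (y : Fin (n + 1) → ℝ), GF.lift (φ i) y = cn s a →
        y 0 = s ∧ φ i (tl y) = a := by
      intro i y hy
      exact cn_inj hy
    refine Mz.cover ι hι (fun i => GF.lift (φ i))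
      (fun i => {y | y 0 ∈ Set.Icc (s - 1) (s + 1) ∧ tl y ∈ K i})
      (fun i => compact_cyl (hK i) _ _) (fun i => ?_) ?_ (fun i y hy hya => ?_) (fun i y hy hya => ?_)
    · exact cn_contOn (continuous_apply 0).continuousOn
        ((hc i).comp tl_cont.continuousOn fun y hy => hy.2)
    · have h1 : ∀ᶠ y : Fin (n + 1) → ℝ in 𝓝 (cn s a), tl y ∈ ⋃ i, φ i '' K i :=
        (tl_cont.tendsto (cn s a)).eventually (by rw [tl_cn]; exact hcov)
      have h2 : ∀ᶠ y : Fin (n + 1) → ℝ in 𝓝 (cn s a), y 0 ∈ Set.Icc (s - 1) (s + 1) :=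
        ((continuous_apply 0).tendsto (cn s a)).eventually
          (Icc_mem_nhds (by simp) (by simp))
      filter_upwards [h1, h2] with y h1 h2
      simp only [Set.mem_iUnion, Set.mem_image] at h1 ⊢
      obtain ⟨i, x, hx, hxy⟩ := h1
      refine ⟨i, cn (y 0) x, ⟨by simpa using h2, by simpa using hx⟩, ?_⟩
      simp [GF.lift, hxy]
    · exact lift_analytic (hA i _ hy.2 (key i y hya).2)
    · obtain ⟨h1, h2⟩ := key i y hya
      have := ih i (tl y) hy.2 h2 (F ∘ GF.lift (φ i)) s (fun ψ b hb hψ hnc => by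
        have := hF (φ i ∘ ψ) b (by simp [hb, h2])
          (AnalyticAt.comp (by rw [hb]; exact hA i _ hy.2 h2) hψ) hnc
        exact this)
      rw [← h1, cn_tl] at this
      exact this
end

/-! ### gradient inequality -/

section
variable {n : ℕ}

/-- inequality on a subset -/
def Lset (f : (Fin n → ℝ) → ℝ) (a : Fin n → ℝ) (T : Set (Fin n → ℝ)) : Prop :=
  ∃ θ ∈ Set.Ioo (0:ℝ) 1, ∃ c > 0, ∀ᶠ x in 𝓝 a, x ∈ T → c * |f x| ^ θ ≤ ‖fderiv ℝ f x‖

lemma Lset.mono {f : (Fin n → ℝ) → ℝ} {a : Fin n → ℝ} {S T : Set (Fin n → ℝ)} (h : S ⊆ T)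
    (hT : Lset f a T) : Lset f a S := by
  obtain ⟨θ, hθ, c, hc, H⟩ := hT
  exact ⟨θ, hθ, c, hc, by filter_upwards [H] with x hx hS using hx (h hS)⟩

lemma Lset.union {f : (Fin n → ℝ) → ℝ} {a : Fin n → ℝ} (hf : ContinuousAt f a) (h0 : f a = 0)
    {S T : Set (Fin n → ℝ)} (hS : Lset f a S) (hT : Lset f a T) : Lset f a (S ∪ T) := by
  obtain ⟨θ, hθ, c, hc, H⟩ := hS
  obtain ⟨θ', hθ', c', hc', H'⟩ := hT
  refine ⟨max θ θ', ⟨lt_max_of_lt_left hθ.1, max_lt hθ.2 hθ'.2⟩, min c c', lt_min hc hc', ?_⟩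
  have h1 : ∀ᶠ x in 𝓝 a, |f x| < 1 := by
    have := hf.abs.tendsto
    simp only [h0, abs_zero] at this
    exact this.eventually (gt_mem_nhds one_pos)
  filter_upwards [H, H', h1] with x h2 h3 h4 hx
  have key : ∀ τ d : ℝ, 0 < τ → τ ≤ max θ θ' → min c c' ≤ d →
      min c c' * |f x| ^ (max θ θ') ≤ d * |f x| ^ τ := by
    intro τ d hτ hτ' hd
    have : |f x| ^ (max θ θ') ≤ |f x| ^ τ := by
      rcases eq_or_lt_of_le (abs_nonneg (f x)) with h | h
      · rw [← h, Real.zero_rpow (by linarith), Real.zero_rpow hτ.ne']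
      · exact Real.rpow_le_rpow_of_exponent_ge h h4.le hτ'
    have hp : 0 < min c c' := lt_min hc hc'
    have hd0 : 0 ≤ d := hp.le.trans hd
    have := Real.rpow_nonneg (abs_nonneg (f x)) (max θ θ')
    gcongr
  rcases hx with hx | hx
  · exact (key θ c hθ.1 (le_max_left _ _) (min_le_left _ _)).trans (h2 hx)
  · exact (key θ' c' hθ'.1 (le_max_right _ _) (min_le_right _ _)).trans (h3 hx)

lemma Lset.empty (f : (Fin n → ℝ) → ℝ) (a : Fin n → ℝ) : Lset f a ∅ :=
  ⟨1/2, ⟨by norm_num, by norm_num⟩, 1, one_pos, by simp⟩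

lemma Lset.cover {f : (Fin n → ℝ) → ℝ} {a : Fin n → ℝ} (hf : AnalyticAt ℝ f a) (h0 : f a = 0)
    {φ : (Fin n → ℝ) → (Fin n → ℝ)} {K : Set (Fin n → ℝ)} (hK : IsCompact K)
    (hc : ContinuousOn φ K) (hA : ∀ b ∈ K, φ b = a → AnalyticAt ℝ φ b)
    (hM : ∀ b ∈ K, φ b = a → Lset (f ∘ φ) b Set.univ) : Lset f a (φ '' K) := by
  refine hK.induction_on (p := fun s => Lset f a (φ '' s)) ?_ ?_ ?_ ?_
  · simpa using Lset.empty f a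
  · intro s t hst ht; exact ht.mono (Set.image_mono hst)
  · intro s t hs ht; rw [Set.image_union]; exact hs.union hf.continuousAt h0 ht
  · intro b hb
    by_cases hba : φ b = a
    · obtain ⟨θ, hθ, c, hc', H⟩ := hM b hb hba
      have hφ := hA b hb hba
      set M := ‖fderiv ℝ φ b‖ + 1 with hMd
      have hM0 : 0 < M := by positivity
      have hbd : ∀ᶠ y in 𝓝 b, ‖fderiv ℝ φ y‖ < M :=
        hφ.fderiv.continuousAt.norm.tendsto.eventually (gt_mem_nhds (by simp [hMd]))
      have hfd : ∀ᶠ y in 𝓝 b, DifferentiableAt ℝ f (φ y) := by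
        have := hφ.continuousAt.tendsto
        rw [hba] at this
        filter_upwards [this.eventually hf.eventually_analyticAt] with y hy
          using hy.differentiableAt
      have hev : ∀ᶠ y in 𝓝 b, c / M * |f (φ y)| ^ θ ≤ ‖fderiv ℝ f (φ y)‖ := by
        filter_upwards [H, hbd, hfd, hφ.eventually_analyticAt] with y h1 h2 h3 h4
        have h1 := h1 trivial
        rw [fderiv_comp y h3 h4.differentiableAt] at h1
        have h5 := h1.trans (ContinuousLinearMap.opNorm_comp_le _ _)
        have h6 : ‖fderiv ℝ f (φ y)‖ * ‖fderiv ℝ φ y‖ ≤ ‖fderiv ℝ f (φ y)‖ * M := by gcongr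
        rw [div_mul_eq_mul_div, div_le_iff₀ hM0]
        exact h5.trans h6
      refine ⟨_, mem_nhdsWithin_of_mem_nhds hev, θ, hθ, c / M, by positivity, ?_⟩
      refine Eventually.of_forall ?_
      rintro x ⟨y, hy, rfl⟩
      exact hy
    · obtain ⟨U, W, hU, hW, hbU, haW, hUW⟩ := t2_separation hba
      refine ⟨φ ⁻¹' U, (hc b hb).tendsto.eventually (hU.mem_nhds hbU), 1/2,
        ⟨by norm_num, by norm_num⟩, 1, one_pos, ?_⟩
      filter_upwards [hW.mem_nhds haW] with x hx hx'
      obtain ⟨y, hy, rfl⟩ := hx'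
      exact absurd hx (Set.disjoint_left.1 hUW hy)

lemma Lset.nc {f : (Fin n → ℝ) → ℝ} {b : Fin n → ℝ} (h0 : f b = 0) (h : NC f b) :
    Lset f b Set.univ := by
  have hfan := h.analyticAt
  obtain ⟨α, u, hu, hu0, he⟩ := h
  set m := ∑ i, α i with hm
  set S : Finset (Fin n) := Finset.univ.filter (fun i => 0 < α i) with hS
  have hSne : S.Nonempty := by
    by_contra hcon
    rw [Finset.not_nonempty_iff_eq_empty, Finset.filter_eq_empty_iff] at hcon
    have h1 : ∀ i, α i = 0 := fun i => by have := hcon (Finset.mem_univ i); omega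
    have := he.self_of_nhds
    simp [h1, h0] at this
    exact hu0 this.symm
  set θ : ℝ := 1 - 1 / ((m : ℝ) + 1) with hθ
  have hm1 : 1 ≤ m := by
    obtain ⟨i, hi⟩ := hSne
    have h1 : 0 < α i := (Finset.mem_filter.1 hi).2
    have : α i ≤ m := Finset.single_le_sum (f := α) (fun _ _ => Nat.zero_le _) (Finset.mem_univ i)
    omega
  have hm1' : (1:ℝ) ≤ m := by exact_mod_cast hm1
  have hθ0 : 0 < θ := by
    rw [hθ, sub_pos, div_lt_one (by positivity)]; linarith
  have hθ1 : θ < 1 := by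
    rw [hθ]; have : 0 < 1 / ((m : ℝ) + 1) := by positivity
    linarith
  set U := |u b| with hU
  have hUpos : 0 < U := abs_pos.2 hu0
  set D := ‖fderiv ℝ u b‖ + 1 with hD
  have hDpos : 0 < D := by positivity
  -- eventual facts
  have h1 : ∀ᶠ x in 𝓝 b, |u x| < 2 * U :=
    hu.continuousAt.abs.tendsto.eventually (gt_mem_nhds (by linarith))
  have h2 : ∀ᶠ x in 𝓝 b, 3/4 * U < |u x| :=
    hu.continuousAt.abs.tendsto.eventually (lt_mem_nhds (by linarith))
  have h3 : ∀ᶠ x in 𝓝 b, ‖fderiv ℝ u x‖ < D :=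
    hu.fderiv.continuousAt.norm.tendsto.eventually (gt_mem_nhds (by simp [hD]))
  have h4 : ∀ᶠ x in 𝓝 b, ∀ i, |x i - b i| < min 1 (U / (4 * D)) := by
    rw [eventually_all]
    intro i
    have : Continuous fun x : Fin n → ℝ => |x i - b i| := by fun_prop
    refine (this.tendsto b).eventually (gt_mem_nhds ?_)
    simp only [sub_self, abs_zero]; positivity
  refine ⟨θ, ⟨hθ0, hθ1⟩, (U / 2) / (2 * U) ^ θ, by positivity, ?_⟩
  filter_upwards [h1, h2, h3, h4, he, he.eventually_nhds, hu.eventually_analyticAt,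
    hfan.eventually_analyticAt] with x h1 h2 h3 h4 hex hexx hux hfx _
  obtain ⟨i, hiS, himin⟩ := S.exists_min_image (fun i => |x i - b i|) hSne
  have hαi : 0 < α i := (Finset.mem_filter.1 hiS).2
  set μ := ∏ i, (x i - b i) ^ α i with hμ
  have hlow : |x i - b i| ^ (m + 1) ≤ |μ| := by
    calc |x i - b i| ^ (m + 1) ≤ |x i - b i| ^ m :=
          pow_le_pow_of_le_one (abs_nonneg _) ((h4 i).le.trans (min_le_left _ _)) (by omega)
      _ = ∏ j, |x i - b i| ^ α j := by rw [hm, Finset.prod_pow_eq_pow_sum]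
      _ ≤ ∏ j, |x j - b j| ^ α j := by
          refine Finset.prod_le_prod (fun j _ => by positivity) fun j _ => ?_
          by_cases hj : 0 < α j
          · exact pow_le_pow_left₀ (abs_nonneg _)
              (himin j (Finset.mem_filter.2 ⟨Finset.mem_univ _, hj⟩)) _
          · have : α j = 0 := by omega
            simp [this]
      _ = |μ| := by rw [hμ, Finset.abs_prod]; simp [abs_pow]
  by_cases hxi : x i - b i = 0
  · have : f x = 0 := by
      rw [hex, hμ, Finset.prod_eq_zero (Finset.mem_univ i) (by rw [hxi]; exact zero_pow hαi.ne'),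
        zero_mul]
    rw [this, abs_zero, Real.zero_rpow hθ0.ne', mul_zero]
    positivity
  -- derivative in direction i
  set y := x i - b i with hy
  set R := ∏ j ∈ Finset.univ.erase i, (x j - b j) ^ α j with hR
  have hμR : μ = y ^ α i * R := by
    rw [hμ, ← Finset.mul_prod_erase _ _ (Finset.mem_univ i)]
  set ei : Fin n → ℝ := Pi.single i 1 with hei
  have hline : HasDerivAt (fun t : ℝ => x + t • ei) ei 0 := by
    simpa using ((hasDerivAt_id (0:ℝ)).smul_const ei).const_add x
  have hx0 : x + (0:ℝ) • ei = x := by simp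
  have hdf : HasDerivAt (fun t : ℝ => f (x + t • ei)) (fderiv ℝ f x ei) 0 := by
    have := hfx.differentiableAt.hasFDerivAt
    rw [← hx0] at this
    have := this.comp_hasDerivAt (0:ℝ) hline
    rwa [hx0] at this
  have hdu : HasDerivAt (fun t : ℝ => u (x + t • ei)) (fderiv ℝ u x ei) 0 := by
    have := hux.differentiableAt.hasFDerivAt
    rw [← hx0] at this
    have := this.comp_hasDerivAt (0:ℝ) hline
    rwa [hx0] at this
  have hdf2 : HasDerivAt (fun t : ℝ => ((y + t) ^ α i * R) * u (x + t • ei))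
      ((α i * y ^ (α i - 1) * R) * u x + (y ^ α i * R) * fderiv ℝ u x ei) 0 := by
    have hp : HasDerivAt (fun t : ℝ => (y + t) ^ α i) (α i * y ^ (α i - 1)) 0 := by
      simpa using ((hasDerivAt_id (0:ℝ)).const_add y).fun_pow (α i)
    have := (hp.mul_const R).fun_mul hdu
    simpa using this
  have heq : (fun t : ℝ => f (x + t • ei)) =ᶠ[𝓝 0]
      (fun t : ℝ => ((y + t) ^ α i * R) * u (x + t • ei)) := by
    have ht : Tendsto (fun t : ℝ => x + t • ei) (𝓝 0) (𝓝 x) := by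
      have := hline.continuousAt.tendsto
      rwa [hx0] at this
    filter_upwards [ht.eventually hexx] with t ht
    rw [ht, ← Finset.mul_prod_erase _ _ (Finset.mem_univ i)]
    congr 2
    · simp [hei, hy]; ring
    · refine Finset.prod_congr rfl fun j hj => ?_
      simp [hei, Finset.ne_of_mem_erase hj]
  have hd := hdf.unique (hdf2.congr_of_eventuallyEq heq)
  have hnorm_ei : ‖ei‖ ≤ 1 := by
    rw [hei]
    rw [Pi.norm_single]; simp
  have hyd : y * fderiv ℝ f x ei = μ * (α i * u x + y * fderiv ℝ u x ei) := by
    rw [hd, hμR]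
    have : y * y ^ (α i - 1) = y ^ α i := by rw [← pow_succ']; congr 1; omega
    linear_combination (α i * R * u x) * this
  have hdub : |fderiv ℝ u x ei| ≤ D := by
    have := (fderiv ℝ u x).le_opNorm ei
    rw [Real.norm_eq_abs] at this
    calc _ ≤ _ := this
      _ ≤ D * 1 := by gcongr
      _ = D := mul_one D
  have hyU : |y| * D ≤ U / 4 := by
    have : |y| ≤ U / (4 * D) := (h4 i).le.trans (min_le_right _ _)
    calc |y| * D ≤ U / (4 * D) * D := by gcongr
      _ = U / 4 := by field_simp
  have hbr : U / 2 ≤ |α i * u x + y * fderiv ℝ u x ei| := by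
    have e1 : |(α i : ℝ) * u x| - |y * fderiv ℝ u x ei| ≤ |α i * u x + y * fderiv ℝ u x ei| := by
      have := abs_sub_abs_le_abs_sub ((α i : ℝ) * u x) (-(y * fderiv ℝ u x ei))
      rwa [abs_neg, sub_neg_eq_add] at this
    have e2 : |y * fderiv ℝ u x ei| ≤ U / 4 := by
      rw [abs_mul]
      exact (mul_le_mul_of_nonneg_left hdub (abs_nonneg _)).trans hyU
    have e3 : |u x| ≤ |(α i : ℝ) * u x| := by
      rw [abs_mul, Nat.abs_cast]
      have : (1:ℝ) ≤ α i := by exact_mod_cast hαi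
      nlinarith [abs_nonneg (u x)]
    linarith
  have hnf : |fderiv ℝ f x ei| ≤ ‖fderiv ℝ f x‖ := by
    have := (fderiv ℝ f x).le_opNorm ei
    rw [Real.norm_eq_abs] at this
    calc _ ≤ _ := this
      _ ≤ ‖fderiv ℝ f x‖ * 1 := by gcongr
      _ = _ := mul_one _
  have hypos : 0 < |y| := abs_pos.2 hxi
  have hμpos : 0 < |μ| := lt_of_lt_of_le (by positivity) hlow
  have hyle : |y| ≤ |μ| ^ (1 / ((m:ℝ) + 1)) := by
    have h5 : |y| = (|y| ^ (m + 1)) ^ (1 / ((m:ℝ) + 1)) := by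
      rw [← Real.rpow_natCast, ← Real.rpow_mul (abs_nonneg _)]
      push_cast
      rw [mul_one_div_cancel (by positivity), Real.rpow_one]
    rw [h5]
    exact Real.rpow_le_rpow (by positivity) hlow (by positivity)
  have hfin : U / 2 * |μ| ^ θ ≤ ‖fderiv ℝ f x‖ := by
    have e1 : |y| * |fderiv ℝ f x ei| = |μ| * |α i * u x + y * fderiv ℝ u x ei| := by
      rw [← abs_mul, hyd, abs_mul]
    have e2 : |μ| = |μ| ^ θ * |μ| ^ (1 / ((m:ℝ) + 1)) := by
      rw [← Real.rpow_add hμpos, hθ]; simp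
    have e3 : |y| * (U / 2 * |μ| ^ θ) ≤ |y| * ‖fderiv ℝ f x‖ := by
      calc |y| * (U / 2 * |μ| ^ θ) ≤ |μ| ^ (1 / ((m:ℝ) + 1)) * (U / 2 * |μ| ^ θ) := by gcongr
        _ = |μ| * (U / 2) := by
            conv_rhs => rw [e2]
            ring
        _ ≤ |μ| * |α i * u x + y * fderiv ℝ u x ei| := by gcongr
        _ = |y| * |fderiv ℝ f x ei| := e1.symm
        _ ≤ _ := by gcongr
    exact le_of_mul_le_mul_left e3 hypos
  refine le_trans ?_ hfin
  have e4 : |f x| ^ θ ≤ |μ| ^ θ * (2 * U) ^ θ := by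
    rw [← Real.mul_rpow (abs_nonneg _) (by positivity)]
    refine Real.rpow_le_rpow (abs_nonneg _) ?_ hθ0.le
    rw [hex, abs_mul]
    gcongr
  calc (U / 2) / (2 * U) ^ θ * |f x| ^ θ ≤ (U / 2) / (2 * U) ^ θ * (|μ| ^ θ * (2 * U) ^ θ) := by
        gcongr
    _ = U / 2 * |μ| ^ θ := by
        have : (2 * U) ^ θ ≠ 0 := by positivity
        field_simp

lemma Mz.loj {f : (Fin n → ℝ) → ℝ} {a : Fin n → ℝ} (h : Mz f a) :
    AnalyticAt ℝ f a → f a = 0 → Lset f a Set.univ := by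
  induction h with
  | nc h => intro _ h0; exact Lset.nc h0 h
  | @cover f a ι hι φ K hK hc hcov hA hM ih =>
    intro hf h0
    have hi : ∀ i, Lset f a (φ i '' K i) := fun i =>
      Lset.cover hf h0 (hK i) (hc i) (hA i) fun b hb hba =>
        ih i b hb hba (AnalyticAt.comp (by rw [hba]; exact hf) (hA i b hb hba)) (by simp [hba, h0])
    have hU : ∀ s : Set ι, s.Finite → Lset f a (⋃ i ∈ s, φ i '' K i) := by
      intro s hs
      induction s, hs using Set.Finite.induction_on with
      | empty => simpa using Lset.empty f a
      | insert _ _ ih =>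
        rw [Set.biUnion_insert]
        exact (hi _).union hf.continuousAt h0 ih
    obtain ⟨θ, hθ, c, hc', H⟩ := hU Set.univ Set.finite_univ
    refine ⟨θ, hθ, c, hc', ?_⟩
    filter_upwards [H, hcov] with x h1 h2 _
    exact h1 (by simpa using h2)

end
end GF

namespace GF

section
variable {n : ℕ}

/-- derivative in the zeroth coordinate -/
noncomputable def pd (F : (Fin (n + 1) → ℝ) → ℝ) (y : Fin (n + 1) → ℝ) : ℝ :=
  deriv (fun t => F (cn t (tl y))) (y 0)

lemma pd_iter (F : (Fin (n + 1) → ℝ) → ℝ) (j : ℕ) (x : Fin n → ℝ) (t : ℝ) :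
    pd^[j] F (cn t x) = iteratedDeriv j (fun t => F (cn t x)) t := by
  induction j generalizing t with
  | zero => simp
  | succ j ih =>
    rw [Function.iterate_succ_apply', iteratedDeriv_succ, pd]
    simp only [tl_cn, cn_zero]
    congr 1
    ext s; exact ih s

lemma pd_lift (F : (Fin (n + 1) → ℝ) → ℝ) (ψ : (Fin n → ℝ) → (Fin n → ℝ)) (j : ℕ)
    (y : Fin (n + 1) → ℝ) : pd^[j] (F ∘ lift ψ) y = pd^[j] F (lift ψ y) := by
  rw [← cn_tl y, pd_iter, lift, pd_iter]
  simp [lift]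

/-- shift in the zeroth coordinate -/
def shift (φ : (Fin n → ℝ) → ℝ) (y : Fin (n + 1) → ℝ) : Fin (n + 1) → ℝ :=
  cn (φ (tl y) + y 0) (tl y)

lemma pd_shift (F : (Fin (n + 1) → ℝ) → ℝ) (φ : (Fin n → ℝ) → ℝ) (j : ℕ)
    (y : Fin (n + 1) → ℝ) : pd^[j] (F ∘ shift φ) y = pd^[j] F (shift φ y) := by
  rw [← cn_tl y, pd_iter, shift, pd_iter]
  simp only [Function.comp_def, shift, tl_cn, cn_zero]
  have := congrFun (iteratedDeriv_comp_const_add j (fun t => F (cn t (tl y))) (φ (tl y))) (y 0)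
  simpa using this

lemma hasDeriv_slice {F : (Fin (n + 1) → ℝ) → ℝ} {y : Fin (n + 1) → ℝ}
    (hF : DifferentiableAt ℝ F y) :
    HasDerivAt (fun t => F (cn t (tl y))) (fderiv ℝ F y (Pi.single 0 1)) (y 0) := by
  have h1 : HasDerivAt (fun t : ℝ => cn t (tl y)) (Pi.single 0 1) (y 0) := by
    rw [hasDerivAt_pi]
    intro i
    refine Fin.cases ?_ (fun j => ?_) i
    · simpa using hasDerivAt_id' (y 0)
    · simpa using hasDerivAt_const (y 0) (y j.succ)
  have h2 := hF.hasFDerivAt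
  have h3 : cn (y 0) (tl y) = y := cn_tl y
  rw [← h3] at h2
  have := h2.comp_hasDerivAt (y 0) h1
  rwa [h3] at this

lemma pd_eq {F : (Fin (n + 1) → ℝ) → ℝ} {y : Fin (n + 1) → ℝ}
    (hF : DifferentiableAt ℝ F y) : pd F y = fderiv ℝ F y (Pi.single 0 1) :=
  (hasDeriv_slice hF).deriv

lemma pd_analytic {F : (Fin (n + 1) → ℝ) → ℝ} {y : Fin (n + 1) → ℝ}
    (hF : AnalyticAt ℝ F y) : AnalyticAt ℝ (pd F) y := by
  have h1 : AnalyticAt ℝ (fun y => fderiv ℝ F y (Pi.single 0 1)) y :=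
    ((ContinuousLinearMap.apply ℝ ℝ (Pi.single 0 1 : Fin (n+1) → ℝ)).analyticAt _).fun_comp hF.fderiv
  refine h1.congr ?_
  filter_upwards [hF.eventually_analyticAt] with x hx
  exact (pd_eq hx.differentiableAt).symm

lemma pd_iter_analytic {F : (Fin (n + 1) → ℝ) → ℝ} {y : Fin (n + 1) → ℝ}
    (hF : AnalyticAt ℝ F y) (j : ℕ) : AnalyticAt ℝ (pd^[j] F) y := by
  induction j with
  | zero => exact hF
  | succ j ih => rw [Function.iterate_succ_apply']; exact pd_analytic ih

lemma pd_congr {F G : (Fin (n + 1) → ℝ) → ℝ} {y : Fin (n + 1) → ℝ}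
    (h : F =ᶠ[𝓝 y] G) : pd F =ᶠ[𝓝 y] pd G := by
  filter_upwards [h.eventually_nhds] with x hx
  refine Filter.EventuallyEq.deriv_eq ?_
  have : Continuous (fun t => cn t (tl x)) := cn_cont continuous_id continuous_const
  have := this.tendsto (x 0)
  rw [cn_tl] at this
  exact this.eventually hx

lemma pd_iter_congr {F G : (Fin (n + 1) → ℝ) → ℝ} {y : Fin (n + 1) → ℝ}
    (h : F =ᶠ[𝓝 y] G) (j : ℕ) : pd^[j] F =ᶠ[𝓝 y] pd^[j] G := by
  induction j with
  | zero => exact h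
  | succ j ih => rw [Function.iterate_succ_apply', Function.iterate_succ_apply']; exact pd_congr ih

lemma pd_add_mul {A : (Fin n → ℝ) → ℝ} {h : (Fin (n + 1) → ℝ) → ℝ} {y : Fin (n + 1) → ℝ}
    (hh : AnalyticAt ℝ h y) (j : ℕ) :
    pd^[j + 1] (fun y => A (tl y) + y 0 * h y) =ᶠ[𝓝 y]
      fun y => y 0 * pd^[j + 1] h y + (j + 1) * pd^[j] h y := by
  induction j with
  | zero =>
    filter_upwards [hh.eventually_analyticAt] with x hx
    have := hasDeriv_slice hx.differentiableAt
    have h2 := ((hasDerivAt_id' (x 0)).fun_mul this).const_add (A (tl x))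
    simp only [zero_add, Function.iterate_one, Function.iterate_zero, id_eq, CharP.cast_eq_zero]
    rw [pd_eq hx.differentiableAt, pd]
    simp only [tl_cn, cn_zero]
    rw [h2.deriv]
    simp
    ring
  | succ j ih =>
    rw [Function.iterate_succ_apply']
    refine (pd_congr ih).trans ?_
    filter_upwards [(pd_iter_analytic hh (j + 1)).eventually_analyticAt,
      (pd_iter_analytic hh j).eventually_analyticAt] with x hx hx'
    have h1 := hasDeriv_slice hx.differentiableAt
    have h1' := hasDeriv_slice hx'.differentiableAt
    have h2 := ((hasDerivAt_id' (x 0)).fun_mul h1).fun_add (h1'.const_mul ((j : ℝ) + 1))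
    rw [pd]
    simp only [cn_zero]
    rw [h2.deriv, Function.iterate_succ_apply' pd (j+1) h, pd_eq hx.differentiableAt,
      ← pd_eq hx'.differentiableAt, ← Function.iterate_succ_apply' pd j h]
    simp only [cn_tl, Function.iterate_succ]
    push_cast
    ring

lemma cn0_tendsto (a : Fin n → ℝ) (s : ℝ) : Tendsto (fun x : Fin n → ℝ => cn s x) (𝓝 a) (𝓝 (cn s a)) :=
  (cn_cont continuous_const continuous_id).tendsto a

lemma taylor {a : Fin n → ℝ} (d : ℕ) : ∀ {F : (Fin (n + 1) → ℝ) → ℝ}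
    (_ : AnalyticAt ℝ F (cn 0 a)),
    ∃ u : (Fin (n + 1) → ℝ) → ℝ, AnalyticAt ℝ u (cn 0 a) ∧
      (∀ᶠ y in 𝓝 (cn 0 a), F y = ∑ i ∈ Finset.range d,
        (pd^[i] F (cn 0 (tl y)) / (i.factorial : ℝ)) * y 0 ^ i + y 0 ^ d * u y) ∧
      pd^[d] F (cn 0 a) = d.factorial * u (cn 0 a) := by
  induction d with
  | zero => intro F hF; exact ⟨F, hF, by simp, by simp⟩
  | succ d ih =>
    intro F hF
    obtain ⟨h, hh, he⟩ := division hF (Pi.single 0 1)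
      (ContinuousLinearMap.proj (R := ℝ) (φ := fun _ : Fin (n+1) => ℝ) 0)
    have he' : F =ᶠ[𝓝 (cn 0 a)] fun y => F (cn 0 (tl y)) + y 0 * h y := by
      filter_upwards [he] with y hy
      rw [hy]
      have : y - (ContinuousLinearMap.proj (R := ℝ) (φ := fun _ : Fin (n+1) => ℝ) 0)
          (y - cn 0 a) • (Pi.single 0 1 : Fin (n+1) → ℝ) = cn 0 (tl y) := by
        ext i
        refine Fin.cases ?_ (fun j => ?_) i
        · simp
        · simp
      rw [this]; simp
    have key : ∀ j, ∀ᶠ x in 𝓝 a, pd^[j + 1] F (cn 0 x) = (j + 1) * pd^[j] h (cn 0 x) := by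
      intro j
      have := (pd_iter_congr he' (j + 1)).trans (pd_add_mul (A := fun x => F (cn 0 x)) hh j)
      filter_upwards [(cn0_tendsto a 0).eventually this] with x hx
      rw [hx]; simp
    obtain ⟨u, hu, hu1, hu2⟩ := ih hh
    refine ⟨u, hu, ?_, ?_⟩
    · have key2 : ∀ᶠ y in 𝓝 (cn 0 a), ∀ j ∈ Finset.range d,
          pd^[j + 1] F (cn 0 (tl y)) = (j + 1) * pd^[j] h (cn 0 (tl y)) := by
        rw [Finset.eventually_all]
        intro j _
        have := tl_cont.tendsto (cn 0 a)
        exact this.eventually (key j)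
      filter_upwards [he', hu1, key2] with y h1 h2 h3
      rw [h1, h2, Finset.sum_range_succ']
      have : ∑ k ∈ Finset.range d, pd^[k + 1] F (cn 0 (tl y)) / ((k + 1).factorial : ℝ) * y 0 ^ (k + 1)
          = y 0 * ∑ k ∈ Finset.range d, pd^[k] h (cn 0 (tl y)) / (k.factorial : ℝ) * y 0 ^ k := by
        rw [Finset.mul_sum]
        refine Finset.sum_congr rfl fun k hk => ?_
        rw [h3 k hk, Nat.factorial_succ]
        push_cast
        have : (k.factorial : ℝ) ≠ 0 := by positivity
        have : (k : ℝ) + 1 ≠ 0 := by positivity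
        field_simp
        ring
      rw [this]
      simp
      ring
    · rw [(key d).self_of_nhds, hu2, Nat.factorial_succ]; push_cast; ring

lemma implicit {G : (Fin (n + 1) → ℝ) → ℝ} {a : Fin n → ℝ} {s : ℝ} (hG : AnalyticAt ℝ G (cn s a))
    (h0 : G (cn s a) = 0) (h1 : pd G (cn s a) ≠ 0) :
    ∃ φ : (Fin n → ℝ) → ℝ, AnalyticAt ℝ φ a ∧ φ a = s ∧ ∀ᶠ x in 𝓝 a, G (cn (φ x) x) = 0 := by
  set f : (Fin n → ℝ) × ℝ → ℝ := fun w => G (cn w.2 w.1) with hf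
  have hfa : AnalyticAt ℝ f (a, s) := by
    refine AnalyticAt.fun_comp (g := G) (f := fun w : (Fin n → ℝ) × ℝ => cn w.2 w.1) hG ?_
    exact cn_analytic analyticAt_snd analyticAt_fst
  have cdf : ContDiffAt ℝ ⊤ f (a, s) := hfa.contDiffAt
  have hd : fderiv ℝ f (a, s) (0, 1) = pd G (cn s a) := by
    have h2 := hfa.differentiableAt.hasFDerivAt
    have h3 : HasDerivAt (fun t : ℝ => ((a, t) : (Fin n → ℝ) × ℝ)) (0, 1) s :=
      (hasDerivAt_const s a).prodMk (hasDerivAt_id s)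
    have := h2.comp_hasDerivAt s h3
    rw [← this.deriv]; rfl
  have hinv : (fderiv ℝ f (a, s) ∘L .inr ℝ (Fin n → ℝ) ℝ).IsInvertible := by
    have : fderiv ℝ f (a, s) ∘L .inr ℝ (Fin n → ℝ) ℝ =
        ((ContinuousLinearEquiv.unitsEquivAut ℝ (Units.mk0 _ h1)) : ℝ →L[ℝ] ℝ) := by
      ext
      simp [hd]
    rw [this]
    exact ContinuousLinearMap.isInvertible_equiv
  refine ⟨cdf.implicitFunction (by simp) hinv, ?_, ?_, ?_⟩
  · exact (cdf.contDiffAt_implicitFunction (by simp) hinv).analyticAt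
  · exact cdf.implicitFunction_apply_self (by simp) hinv
  · have := cdf.eventually_apply_implicitFunction (by simp) hinv
    filter_upwards [this] with x hx
    rw [← h0]; exact hx
end
end GF

namespace GF

section
variable {n : ℕ}

/-- monomialization in dimension n -/
def Mon (n : ℕ) : Prop := ∀ (f : (Fin n → ℝ) → ℝ) (a : Fin n → ℝ), AnalyticAt ℝ f a →
  (¬ ∀ᶠ x in 𝓝 a, f x = 0) → Mz f a

/-- monomialization for functions of order less than d in the zeroth variable -/
def SD (n d : ℕ) : Prop := ∀ (F : (Fin (n + 1) → ℝ) → ℝ) (g : (Fin n → ℝ) → ℝ)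
  (y : Fin (n + 1) → ℝ), AnalyticAt ℝ F y → AnalyticAt ℝ g (tl y) →
  (¬ ∀ᶠ x in 𝓝 (tl y), g x = 0) → (∃ j < d, pd^[j] F y ≠ 0) → Mz (fun y => F y * g (tl y)) y

lemma multi (hM : Mon n) {ι : Type*} (J : Finset ι) (H : ι → (Fin n → ℝ) → ℝ) {a : Fin n → ℝ}
    (hH : ∀ i ∈ J, AnalyticAt ℝ (H i) a) (F : (Fin (n + 1) → ℝ) → ℝ) (s : ℝ)
    (hyp : ∀ (ψ : (Fin n → ℝ) → (Fin n → ℝ)) (b : Fin n → ℝ), ψ b = a → AnalyticAt ℝ ψ b →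
      (∀ i ∈ J, ((∀ᶠ x in 𝓝 a, H i x = 0) ∧ ∀ᶠ x in 𝓝 b, H i (ψ x) = 0) ∨
        NC (fun x => H i (ψ x)) b) → Mz (F ∘ lift ψ) (cn s b)) : Mz F (cn s a) := by
  classical
  set J' := J.filter (fun i => ¬ ∀ᶠ x in 𝓝 a, H i x = 0) with hJ'
  have hJsub : ∀ i ∈ J', i ∈ J := fun i hi => (Finset.mem_filter.1 hi).1
  have han : AnalyticAt ℝ (fun x => ∏ i ∈ J', H i x) a :=
    Finset.analyticAt_fun_prod _ fun i hi => hH i (hJsub i hi)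
  have hne : ¬ ∀ᶠ x in 𝓝 a, ∏ i ∈ J', H i x = 0 :=
    prod_zero_germ _ (fun i hi => hH i (hJsub i hi)) fun i hi => (Finset.mem_filter.1 hi).2
  refine (hM _ a han hne).lift F s fun ψ b hb hψ hnc => hyp ψ b hb hψ fun i hi => ?_
  have hcomp : ∀ i ∈ J, AnalyticAt ℝ (fun x => H i (ψ x)) b := fun i hi =>
    AnalyticAt.fun_comp (by rw [hb]; exact hH i hi) hψ
  by_cases h0 : ∀ᶠ x in 𝓝 a, H i x = 0
  · left
    refine ⟨h0, ?_⟩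
    have := hψ.continuousAt.tendsto
    rw [hb] at this
    exact this.eventually h0
  · right
    have hi' : i ∈ J' := Finset.mem_filter.2 ⟨hi, h0⟩
    refine NC.of_mul (g := fun x => ∏ j ∈ J'.erase i, H j (ψ x)) (hcomp i hi)
      (Finset.analyticAt_fun_prod _ fun j hj => hcomp j (hJsub j (Finset.mem_of_mem_erase hj))) ?_
    refine hnc.congr (Eventually.of_forall fun x => ?_)
    exact Finset.mul_prod_erase J' (fun j => H j (ψ x)) hi'

end
end GF

namespace GF

section
variable {n : ℕ}

lemma iter_poly (p : Polynomial ℝ) (j : ℕ) (t : ℝ) :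
    iteratedDeriv j (fun t => p.eval t) t = (Polynomial.derivative^[j] p).eval t := by
  induction j generalizing t with
  | zero => simp
  | succ j ih =>
    rw [iteratedDeriv_succ, Function.iterate_succ_apply', ← Polynomial.deriv]
    congr 1; ext s; exact ih s

lemma poly_order (d : ℕ) (u0 : ℝ) (hu0 : u0 ≠ 0) (e : ℕ → ℝ) (k : ℕ) (hk : k + 1 < d)
    (hek : e k ≠ 0) (z0 : ℝ) :
    ∃ j < d, iteratedDeriv j (fun t => t ^ d * u0 + ∑ i ∈ Finset.range (d - 1), e i * t ^ i) z0 ≠ 0 := by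
  set p : Polynomial ℝ := Polynomial.C u0 * Polynomial.X ^ d +
    ∑ i ∈ Finset.range (d - 1), Polynomial.C (e i) * Polynomial.X ^ i with hp
  have hev : (fun t : ℝ => t ^ d * u0 + ∑ i ∈ Finset.range (d - 1), e i * t ^ i) =
      fun t => p.eval t := by
    ext t
    simp [hp, Polynomial.eval_finsetSum]
    ring
  rw [hev]
  simp only [iter_poly]
  by_cases hz : z0 = 0
  · refine ⟨k, by omega, ?_⟩
    rw [hz, ← Polynomial.coeff_zero_eq_eval_zero, Polynomial.coeff_iterate_derivative]
    have : p.coeff (0 + k) = e k := by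
      simp only [hp, Polynomial.coeff_add, Polynomial.coeff_C_mul, Polynomial.coeff_X_pow,
        Polynomial.finsetSum_coeff, zero_add]
      rw [if_neg (by omega)]
      simp [Finset.sum_ite_eq]
      intro h; omega
    rw [this, nsmul_eq_mul]
    refine mul_ne_zero ?_ hek
    simp [Nat.descFactorial_eq_zero_iff_lt]
  · refine ⟨d - 1, by omega, ?_⟩
    have : Polynomial.derivative^[d - 1] p =
        Polynomial.C u0 * (Polynomial.C (Nat.descFactorial d (d - 1) : ℝ) * Polynomial.X ^ 1) := by
      rw [hp, iterate_map_add, Polynomial.iterate_derivative_C_mul,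
        Polynomial.iterate_derivative_X_pow_eq_C_mul, Polynomial.iterate_derivative_sum,
        Finset.sum_eq_zero, add_zero, show d - (d - 1) = 1 by omega]
      intro i hi
      apply Polynomial.iterate_derivative_eq_zero
      have := Finset.mem_range.1 hi
      exact (Polynomial.natDegree_C_mul_X_pow_le _ _).trans_lt this
    rw [this]
    simp [hu0, hz, Nat.descFactorial_eq_zero_iff_lt]

/-- the box -/
def box (n : ℕ) (A : ℝ) : Set (Fin n → ℝ) := Set.univ.pi fun _ => Set.Icc (-A) A

lemma box_compact (A : ℝ) : IsCompact (box n A) := isCompact_univ_pi fun _ => isCompact_Icc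

lemma mem_box {A : ℝ} {y : Fin n → ℝ} : y ∈ box n A ↔ ∀ i, |y i| ≤ A := by
  simp only [box, Set.mem_univ_pi, Set.mem_Icc, abs_le]

/-- partial product of coordinates -/
def PP (S : Finset (Fin n)) (w : Fin n → ℝ) : ℝ := ∏ j ∈ S, w j

lemma PP_analytic (S : Finset (Fin n)) (w : Fin n → ℝ) : AnalyticAt ℝ (PP S) w :=
  Finset.analyticAt_fun_prod _ fun i _ => analyticAt_coord i w

lemma PP_nc (S : Finset (Fin n)) (w : Fin n → ℝ) : NC (PP S) w :=
  NC.prod S fun i _ => NC.coord i w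

lemma PP_cont (S : Finset (Fin n)) : Continuous (PP S) := by
  unfold PP; fun_prop

/-- first chart -/
def ch1 (S : Finset (Fin n)) (B : ℕ) (y : Fin (n + 1) → ℝ) : Fin (n + 1) → ℝ :=
  cn (y 0 * PP S (tl y) ^ B) (tl y)

lemma ch1_analytic (S : Finset (Fin n)) (B : ℕ) (y : Fin (n + 1) → ℝ) :
    AnalyticAt ℝ (ch1 S B) y :=
  cn_analytic ((analyticAt_coord 0 y).mul (((PP_analytic S _).fun_comp (tl_analytic y)).pow B))
    (tl_analytic y)

lemma an_cont {E F : Type*} [NormedAddCommGroup E] [NormedSpace ℝ E] [NormedAddCommGroup F]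
    [NormedSpace ℝ F] {f : E → F} (h : ∀ x, AnalyticAt ℝ f x) : Continuous f :=
  continuous_iff_continuousAt.2 fun x => (h x).continuousAt

/-- tail part of the second chart -/
def ch2w (k : Fin n) (y : Fin (n + 1) → ℝ) : Fin n → ℝ :=
  Function.update (tl y) k (y 0 * y k.succ)

/-- the root variable of the second chart -/
def ch2z (T : Finset (Fin n)) (y : Fin (n + 1) → ℝ) : ℝ := PP T (tl y) * y 0

/-- second chart, with c the signed constant -/
def ch2 (c : ℝ) (B : ℕ) (T : Finset (Fin n)) (k : Fin n) (y : Fin (n + 1) → ℝ) :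
    Fin (n + 1) → ℝ :=
  cn (c * ch2z T y ^ B) (ch2w k y)

lemma ch2w_nc (k j : Fin n) (y : Fin (n + 1) → ℝ) : NC (fun y => ch2w k y j) y := by
  by_cases h : j = k
  · subst h
    simpa [ch2w] using (NC.coord 0 y).mul (NC.coord j.succ y)
  · simpa [ch2w, h] using NC.coord j.succ y

lemma ch2w_analytic (k : Fin n) (y : Fin (n + 1) → ℝ) : AnalyticAt ℝ (ch2w k) y := by
  rw [analyticAt_pi_iff]; intro j; exact (ch2w_nc k j y).analyticAt

lemma ch2z_nc (T : Finset (Fin n)) (y : Fin (n + 1) → ℝ) : NC (ch2z T) y :=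
  (NC.prod T fun i _ => NC.coord i.succ y).mul (NC.coord 0 y)

lemma ch2_analytic (c : ℝ) (B : ℕ) (T : Finset (Fin n)) (k : Fin n) (y : Fin (n + 1) → ℝ) :
    AnalyticAt ℝ (ch2 c B T k) y :=
  cn_analytic (analyticAt_const.mul ((ch2z_nc T y).analyticAt.pow B)) (ch2w_analytic k y)

lemma PP_split (S T : Finset (Fin n)) (k : Fin n) (hk : k ∈ S) (hT : T ⊆ S.erase k)
    (y : Fin (n + 1) → ℝ) :
    PP S (ch2w k y) = ch2z T y * (y k.succ * PP (S.erase k \ T) (tl y)) := by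
  have h1 : PP S (ch2w k y) = (y 0 * y k.succ) * PP (S.erase k) (tl y) := by
    unfold PP
    rw [← Finset.mul_prod_erase S _ hk]
    congr 1
    · simp [ch2w]
    · refine Finset.prod_congr rfl fun j hj => ?_
      simp [ch2w, Finset.ne_of_mem_erase hj]
  have h2 : PP (S.erase k) (tl y) = PP (S.erase k \ T) (tl y) * PP T (tl y) :=
    (Finset.prod_sdiff hT).symm
  rw [h1, h2, ch2z]; ring

/-- covering property -/
lemma ch2_cover (S : Finset (Fin n)) (B : ℕ) (hB : 1 ≤ B) (A : ℝ) (hA : 0 < A)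
    (y : Fin (n + 1) → ℝ) (hy : ∀ i, |y i| < min 1 A) (hS : A * |PP S (tl y)| ^ B ≤ |y 0|) :
    ∃ σ : ℝ, (σ = 1 ∨ σ = -1) ∧ ∃ T k, k ∈ S ∧ T ⊆ S.erase k ∧
      ∃ v ∈ box (n + 1) 1, ch2 (σ * A) B T k v = y := by
  classical
  have hB' : (B : ℝ) ≠ 0 := by positivity
  set ζ : ℝ := (|y 0| / A) ^ (1 / (B : ℝ)) with hζ
  have hζ0 : 0 ≤ ζ := by positivity
  have hζB : ζ ^ B = |y 0| / A := by
    rw [hζ, ← Real.rpow_natCast, ← Real.rpow_mul (by positivity), one_div_mul_cancel hB',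
      Real.rpow_one]
  have hlt : |y 0| / A < 1 := by
    rw [div_lt_one hA]; exact (hy 0).trans_le (min_le_right _ _)
  have hζ1 : ζ < 1 := by
    by_contra hcon
    push Not at hcon
    have := one_le_pow₀ hcon (n := B)
    rw [hζB] at this
    linarith
  have hPS : |PP S (tl y)| ≤ ζ := by
    refine le_of_pow_le_pow_left₀ (by omega : B ≠ 0) hζ0 ?_
    rw [hζB, le_div_iff₀ hA, mul_comm]; exact hS
  obtain ⟨T', hT', hmin⟩ := (S.powerset.filter (fun T => |PP T (tl y)| ≤ ζ)).exists_min_image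
    Finset.card ⟨S, by simp [hPS]⟩
  simp only [Finset.mem_filter, Finset.mem_powerset] at hT' hmin
  have hne : T'.Nonempty := by
    by_contra hcon
    rw [Finset.not_nonempty_iff_eq_empty] at hcon
    have := hT'.2
    simp [hcon, PP] at this
    linarith
  obtain ⟨k, hk⟩ := hne
  set T := T'.erase k with hT
  have hTgt : ζ < |PP T (tl y)| := by
    by_contra hcon
    push Not at hcon
    have := hmin T ⟨(Finset.erase_subset _ _).trans hT'.1, hcon⟩
    have : T.card < T'.card := Finset.card_erase_lt_of_mem hk
    omega
  have hTpos : 0 < |PP T (tl y)| := hζ0.trans_lt hTgt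
  have hT0 : PP T (tl y) ≠ 0 := abs_pos.1 hTpos
  have hprod : |y k.succ| * |PP T (tl y)| ≤ ζ := by
    have : PP T' (tl y) = tl y k * PP T (tl y) := (Finset.mul_prod_erase T' _ hk).symm
    have h2 := hT'.2
    rwa [this, abs_mul] at h2
  set ζ' := ζ / PP T (tl y) with hζ'
  have hζ'abs : |ζ'| = ζ / |PP T (tl y)| := by rw [hζ', abs_div, abs_of_nonneg hζ0]
  have hyk : |y k.succ| ≤ |ζ'| := by rw [hζ'abs, le_div_iff₀ hTpos]; exact hprod
  have hζ'1 : |ζ'| ≤ 1 := by rw [hζ'abs, div_le_one hTpos]; exact hTgt.le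
  set v : Fin (n + 1) → ℝ := cn ζ' (Function.update (tl y) k (y k.succ / ζ')) with hv
  have hkv : ζ' * (y k.succ / ζ') = y k.succ := by
    by_cases h : ζ' = 0
    · rw [h, abs_zero] at hyk
      have : y k.succ = 0 := abs_nonpos_iff.1 hyk
      simp [this]
    · field_simp
  have hPT : PP T (tl v) = PP T (tl y) := by
    refine Finset.prod_congr rfl fun j hj => ?_
    have : j ≠ k := Finset.ne_of_mem_erase hj
    simp [hv, this]
  have hz : ch2z T v = ζ := by
    rw [ch2z, hPT]; simp only [hv, cn_zero, hζ']; field_simp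
  have hw : ch2w k v = tl y := by
    ext j
    by_cases h : j = k
    · subst h; simp [ch2w, hv, hkv]
    · simp [ch2w, hv, h]
  obtain ⟨σ, hσ, hσy⟩ : ∃ σ : ℝ, (σ = 1 ∨ σ = -1) ∧ σ * |y 0| = y 0 := by
    rcases le_total 0 (y 0) with h | h
    · exact ⟨1, Or.inl rfl, by rw [abs_of_nonneg h, one_mul]⟩
    · exact ⟨-1, Or.inr rfl, by rw [abs_of_nonpos h]; ring⟩
  refine ⟨σ, hσ, T, k, hT'.1 hk, Finset.erase_subset_erase _ hT'.1, v, ?_, ?_⟩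
  · rw [mem_box]
    intro i
    refine Fin.cases ?_ (fun j => ?_) i
    · simpa [hv] using hζ'1
    · by_cases h : j = k
      · subst h
        simp only [hv, cn_succ, Function.update_self, abs_div]
        exact div_le_one_of_le₀ hyk (abs_nonneg _)
      · simp only [hv, cn_succ, ne_eq, h, not_false_eq_true, Function.update_of_ne]
        exact (hy j.succ).le.trans (min_le_left _ _)
  · rw [ch2, hz, hw, hζB]
    have : σ * A * (|y 0| / A) = y 0 := by rw [← hσy]; field_simp; simp [hσy]
    rw [this, cn_tl]

lemma leaf2 {d : ℕ} (IH : SD n d) (S : Finset (Fin n)) (hS : S.Nonempty) (B : ℕ) (hB : 1 ≤ B)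
    {u : (Fin (n + 1) → ℝ) → ℝ} (hu : AnalyticAt ℝ u 0) (hu0 : u 0 ≠ 0)
    {e : ℕ → (Fin n → ℝ) → ℝ} (he : ∀ i < d - 1, AnalyticAt ℝ (e i) 0)
    {k : ℕ} (hk : k + 1 < d) (hek : e k 0 ≠ 0) {g : (Fin n → ℝ) → ℝ} (hg : NC g 0)
    {G : (Fin (n + 1) → ℝ) → ℝ}
    (hG : ∀ᶠ y in 𝓝 0, G y = (y 0 ^ d * u y + ∑ i ∈ Finset.range (d - 1),
      PP S (tl y) ^ (B * (d - i)) * e i (tl y) * y 0 ^ i) * g (tl y)) : Mz G 0 := by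
  classical
  obtain ⟨A, hA1, hAu⟩ : ∃ A : ℝ, 1 ≤ A ∧ ∑ i ∈ Finset.range (d - 1), |e i 0| < A * |u 0| := by
    have hup : 0 < |u 0| := abs_pos.2 hu0
    refine ⟨max 1 ((∑ i ∈ Finset.range (d - 1), |e i 0| + 1) / |u 0|), le_max_left _ _, ?_⟩
    have := le_max_right 1 ((∑ i ∈ Finset.range (d - 1), |e i 0| + 1) / |u 0|)
    rw [div_le_iff₀ hup] at this
    linarith
  have hA0 : 0 < A := by linarith
  refine Mz.congr ?_ hG
  clear hG G
  set φ : Option (Bool × Finset (Fin n) × Fin n) → (Fin (n + 1) → ℝ) → (Fin (n + 1) → ℝ) :=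
    fun i => match i with
      | none => ch1 S B
      | some (b, T, k) => ch2 ((if b then 1 else -1) * A) B T k with hφ
  set K : Option (Bool × Finset (Fin n) × Fin n) → Set (Fin (n + 1) → ℝ) :=
    fun i => match i with
      | none => box (n + 1) A
      | some (_, T, k) => if k ∈ S ∧ T ⊆ S.erase k then box (n + 1) 1 else ∅ with hK
  have hφan : ∀ i y, AnalyticAt ℝ (φ i) y := by
    rintro (_ | ⟨b, T, k⟩) y
    · exact ch1_analytic S B y
    · exact ch2_analytic _ B T k y
  have hmin : 0 < min 1 A := lt_min one_pos hA0
  have hsmall : ∀ᶠ y : Fin (n + 1) → ℝ in 𝓝 0, ∀ i, |y i| < min 1 A := by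
    rw [eventually_all]
    intro i
    have : Continuous fun x : Fin (n + 1) → ℝ => |x i| := by fun_prop
    refine (this.tendsto 0).eventually (gt_mem_nhds ?_)
    simpa using hmin
  refine Mz.cover _ inferInstance φ K ?_ (fun i => (an_cont (hφan i)).continuousOn) ?_
    (fun i y _ _ => hφan i y) ?_
  · rintro (_ | ⟨b, T, k⟩)
    · exact box_compact A
    · by_cases h : k ∈ S ∧ T ⊆ S.erase k
      · simpa [hK, h] using box_compact 1
      · simp [hK, h]
  · filter_upwards [hsmall] with y hy
    rw [Set.mem_iUnion]
    by_cases hc : A * |PP S (tl y)| ^ B ≤ |y 0|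
    · obtain ⟨σ, hσ, T, k, hk, hT, v, hv, hvy⟩ := ch2_cover S B hB A hA0 y hy hc
      rcases hσ with hσ | hσ
      · exact ⟨some (true, T, k), v, by simpa [hK, hk, hT] using hv, by simpa [hφ, hσ] using hvy⟩
      · exact ⟨some (false, T, k), v, by simpa [hK, hk, hT] using hv, by simpa [hφ, hσ] using hvy⟩
    · push Not at hc
      refine ⟨none, cn (y 0 / PP S (tl y) ^ B) (tl y), ?_, ?_⟩
      · show _ ∈ box (n + 1) A
        rw [mem_box]
        intro i
        refine Fin.cases ?_ (fun j => ?_) i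
        · simp only [cn_zero, abs_div, abs_pow]
          exact div_le_of_le_mul₀ (by positivity) hA0.le hc.le
        · simpa using (hy j.succ).le.trans (min_le_right _ _)
      · show ch1 S B _ = y
        have hP : PP S (tl y) ^ B ≠ 0 := by
          intro h
          rw [← abs_pow, h, abs_zero, mul_zero] at hc
          exact absurd hc (not_lt.2 (abs_nonneg _))
        simp only [ch1, cn_zero, tl_cn]
        rw [div_mul_cancel₀ _ hP, cn_tl]
  · rintro (_ | ⟨σ, T, k'⟩) b hb hb0
    · -- first chart
      have hb0' : ch1 S B b = 0 := hb0
      have htl : tl b = 0 := by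
        have := congrArg tl hb0'
        rw [ch1, tl_cn] at this; exact this
      have hPP0 : PP S (0 : Fin n → ℝ) = 0 := by
        obtain ⟨j, hj⟩ := hS
        exact Finset.prod_eq_zero hj rfl
      set F1 : (Fin (n + 1) → ℝ) → ℝ := fun y => y 0 ^ d * u (ch1 S B y) +
        ∑ i ∈ Finset.range (d - 1), e i (tl y) * y 0 ^ i with hF1
      have hF1an : AnalyticAt ℝ F1 b := by
        refine AnalyticAt.fun_add (((analyticAt_coord 0 b).pow d).fun_mul
          (AnalyticAt.fun_comp (by rw [hb0']; exact hu) (ch1_analytic S B b))) ?_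
        refine Finset.analyticAt_fun_sum _ fun i hi => ?_
        exact (AnalyticAt.fun_comp (by rw [htl]; exact he i (Finset.mem_range.1 hi))
          (tl_analytic b)).fun_mul ((analyticAt_coord 0 b).pow i)
      have hg1 : NC (fun w => PP S w ^ (B * d) * g w) 0 := ((PP_nc S 0).pow _).mul hg
      have := IH F1 (fun w => PP S w ^ (B * d) * g w) b hF1an (by rw [htl]; exact hg1.analyticAt)
        (by rw [htl]; exact hg1.germ) (by
          obtain ⟨j, hj, hj'⟩ := poly_order d (u 0) hu0 (fun i => e i 0) k hk hek (b 0)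
          refine ⟨j, hj, ?_⟩
          rw [← cn_tl b, htl, pd_iter]
          convert hj' using 3 with t
          simp only [hF1, cn_zero, tl_cn, ch1, hPP0]
          congr 3
          rw [zero_pow (by omega), mul_zero]
          ext i; refine Fin.cases ?_ (fun j => ?_) i <;> simp)
      refine this.congr (Eventually.of_forall fun y => ?_)
      show (_ : ℝ) = _
      simp only [Function.comp, hφ, hF1]
      have e1 : tl (ch1 S B y) = tl y := rfl
      have e2 : ch1 S B y 0 = y 0 * PP S (tl y) ^ B := rfl
      rw [e1, e2, mul_comm (PP S (tl y) ^ (B * d)), ← mul_assoc, mul_right_comm]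
      congr 1
      rw [add_mul, Finset.sum_mul]
      congr 1
      · rw [mul_pow, ← pow_mul]; ring
      · refine Finset.sum_congr rfl fun i hi => ?_
        have hi' := Finset.mem_range.1 hi
        have : B * d = B * (d - i) + B * i := by rw [← mul_add]; congr 1; omega
        rw [mul_pow, ← pow_mul, this, pow_add]; ring
    · -- second chart
      by_cases hval : k' ∈ S ∧ T ⊆ S.erase k'
      swap
      · simp [hK, hval] at hb
      have hb1 : ∀ i, |b i| ≤ 1 := by
        rw [← mem_box]; simpa [hK, hval] using hb
      set c : ℝ := (if σ then 1 else -1) * A with hc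
      have hcabs : |c| = A := by
        rw [hc, abs_mul, abs_of_pos hA0]; split_ifs <;> simp
      have hb0' : ch2 c B T k' b = 0 := hb0
      have hw0 : ch2w k' b = 0 := by
        have := congrArg tl hb0'
        rw [ch2, tl_cn] at this; exact this
      set Q : (Fin (n + 1) → ℝ) → ℝ := fun y => y k'.succ * PP (S.erase k' \ T) (tl y) with hQ
      have hQan : AnalyticAt ℝ Q b :=
        (analyticAt_coord _ b).fun_mul ((PP_analytic _ _).fun_comp (tl_analytic b))
      have hQ1 : |Q b| ≤ 1 := by
        rw [hQ, abs_mul, PP, Finset.abs_prod]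
        exact mul_le_one₀ (hb1 _) (Finset.prod_nonneg fun _ _ => abs_nonneg _)
          (Finset.prod_le_one (fun _ _ => abs_nonneg _) fun _ _ => hb1 _)
      set V : (Fin (n + 1) → ℝ) → ℝ := fun y => c ^ d * u (ch2 c B T k' y) +
        ∑ i ∈ Finset.range (d - 1), c ^ i * (Q y ^ (B * (d - i)) * e i (ch2w k' y)) with hV
      have hVan : AnalyticAt ℝ V b := by
        refine AnalyticAt.fun_add (analyticAt_const.fun_mul
          (AnalyticAt.fun_comp (by rw [hb0']; exact hu) (ch2_analytic c B T k' b))) ?_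
        refine Finset.analyticAt_fun_sum _ fun i hi => ?_
        exact analyticAt_const.fun_mul ((hQan.pow _).fun_mul
          (AnalyticAt.fun_comp (by rw [hw0]; exact he i (Finset.mem_range.1 hi))
          (ch2w_analytic k' b)))
      have hV0 : V b ≠ 0 := by
        have h1 : |∑ i ∈ Finset.range (d - 1), c ^ i * (Q b ^ (B * (d - i)) * e i (ch2w k' b))| ≤
            A ^ (d - 1) * ∑ i ∈ Finset.range (d - 1), |e i 0| := by
          rw [Finset.mul_sum]
          refine (Finset.abs_sum_le_sum_abs _ _).trans (Finset.sum_le_sum fun i hi => ?_)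
          have hi' := Finset.mem_range.1 hi
          rw [abs_mul, abs_pow, hcabs, abs_mul, abs_pow, hw0]
          have h2 : |Q b| ^ (B * (d - i)) ≤ 1 := pow_le_one₀ (abs_nonneg _) hQ1
          have h3 : A ^ i ≤ A ^ (d - 1) := pow_le_pow_right₀ hA1 hi'.le
          have h4 : |Q b| ^ (B * (d - i)) * |e i 0| ≤ |e i 0| :=
            mul_le_of_le_one_left (abs_nonneg _) h2
          gcongr
        have h2 : |c ^ d * u (ch2 c B T k' b)| = A ^ (d - 1) * (A * |u 0|) := by
          rw [abs_mul, abs_pow, hcabs, hb0', ← mul_assoc, ← pow_succ]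
          congr 2; omega
        have h3 : A ^ (d - 1) * ∑ i ∈ Finset.range (d - 1), |e i 0| < A ^ (d - 1) * (A * |u 0|) := by
          have : 0 < A ^ (d - 1) := by positivity
          gcongr
        intro h
        rw [hV] at h
        have h4 := eq_neg_of_add_eq_zero_left h
        rw [h4, abs_neg] at h2
        linarith
      obtain ⟨γ, v, hv, hv0, hge⟩ := hg
      have hgnc : NC (fun y => g (ch2w k' y)) b := by
        have h1 : NC (fun y => (∏ i, (ch2w k' y i) ^ γ i) * v (ch2w k' y)) b := by
          refine NC.mul (NC.prod _ fun i _ => (ch2w_nc k' i b).pow _) (NC.unit ?_ ?_)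
          · exact AnalyticAt.fun_comp (by rw [hw0]; exact hv) (ch2w_analytic k' b)
          · rw [hw0]; exact hv0
        refine h1.congr ?_
        have := (ch2w_analytic k' b).continuousAt.tendsto
        rw [hw0] at this
        filter_upwards [this.eventually hge] with y hy
        simpa using hy
      refine Mz.nc (((((ch2z_nc T b).pow (B * d)).mul (NC.unit hVan hV0)).mul hgnc).congr
        (Eventually.of_forall fun y => ?_))
      show (_ : ℝ) = _
      simp only [Function.comp, hφ, hV]
      have e1 : tl (ch2 c B T k' y) = ch2w k' y := rfl
      have e2 : ch2 c B T k' y 0 = c * ch2z T y ^ B := rfl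
      rw [e1, e2, PP_split S T k' hval.1 hval.2 y]
      congr 1
      rw [mul_add, Finset.mul_sum]
      congr 1
      · rw [mul_pow, ← pow_mul]; ring
      · refine Finset.sum_congr rfl fun i hi => ?_
        have hi' := Finset.mem_range.1 hi
        have : B * d = B * (d - i) + B * i := by rw [← mul_add]; congr 1; omega
        rw [mul_pow, mul_pow c, ← pow_mul, this, pow_add]; ring
end
end GF

namespace GF

section
variable {n : ℕ}

lemma NC.tl {g : (Fin n → ℝ) → ℝ} {y : Fin (n + 1) → ℝ} (hg : NC g (GF.tl y)) :
    NC (fun y => g (GF.tl y)) y := by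
  obtain ⟨α, u, hu, hu0, he⟩ := hg
  have h1 : NC (fun x => (∏ i, (x (Fin.succ i) - y (Fin.succ i)) ^ α i) * u (GF.tl x)) y :=
    NC.mul (NC.prod _ fun i _ => (NC.coord_sub i.succ y).pow _)
      (NC.unit (AnalyticAt.fun_comp hu (tl_analytic y)) hu0)
  refine h1.congr ?_
  filter_upwards [(tl_cont.tendsto y).eventually he] with x hx
  exact hx

/-- sign of a boolean -/
def sg (b : Bool) : ℝ := if b then 1 else -1

lemma sg_ne (b : Bool) : sg b ≠ 0 := by cases b <;> simp [sg]

lemma root_cover (ε : ℕ) (hε : 1 ≤ ε) (t : ℝ) (ht : |t| ≤ 1) :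
    ∃ (s : Bool) (v : ℝ), |v| ≤ 1 ∧ sg s * v ^ ε = t := by
  have hε' : (ε : ℝ) ≠ 0 := by positivity
  have h1 : (|t| ^ (1 / (ε : ℝ))) ^ ε = |t| := by
    rw [← Real.rpow_natCast, ← Real.rpow_mul (by positivity), one_div_mul_cancel hε',
      Real.rpow_one]
  have h2 : |(|t| ^ (1 / (ε : ℝ)))| ≤ 1 := by
    rw [abs_of_nonneg (by positivity)]
    exact Real.rpow_le_one (abs_nonneg _) ht (by positivity)
  rcases le_total 0 t with h | h
  · exact ⟨true, _, h2, by rw [h1, abs_of_nonneg h]; simp [sg]⟩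
  · exact ⟨false, _, h2, by rw [h1, abs_of_nonpos h]; simp [sg]⟩

/-- power substitution -/
def psub (b : Fin n → ℝ) (ε : Fin n → ℕ) (σ : Fin n → Bool) (y : Fin n → ℝ) : Fin n → ℝ :=
  fun j => b j + sg (σ j) * y j ^ ε j

lemma psub_analytic (b : Fin n → ℝ) (ε : Fin n → ℕ) (σ : Fin n → Bool) (y : Fin n → ℝ) :
    AnalyticAt ℝ (psub b ε σ) y := by
  rw [analyticAt_pi_iff]; intro j
  exact analyticAt_const.fun_add (analyticAt_const.fun_mul ((analyticAt_coord j y).pow _))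

lemma psub_eq {b : Fin n → ℝ} {ε : Fin n → ℕ} (hε : ∀ j, 1 ≤ ε j) {σ : Fin n → Bool}
    {y : Fin n → ℝ} : psub b ε σ y = b ↔ y = 0 := by
  constructor
  · intro h
    ext j
    have := congrFun h j
    simp only [psub, add_eq_left, mul_eq_zero, sg_ne, false_or] at this
    exact (pow_eq_zero_iff (by have := hε j; omega)).1 this
  · rintro rfl
    ext j
    simp [psub, zero_pow (show ε j ≠ 0 by have := hε j; omega)]

lemma Mz.psub {b : Fin n → ℝ} {ε : Fin n → ℕ} (hε : ∀ j, 1 ≤ ε j) {G : (Fin (n + 1) → ℝ) → ℝ}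
    (h : ∀ σ, Mz (G ∘ GF.lift (psub b ε σ)) 0) : Mz G (cn 0 b) := by
  have hlan : ∀ σ y, AnalyticAt ℝ (GF.lift (GF.psub b ε σ)) y := fun σ y =>
    lift_analytic (psub_analytic _ _ _ _)
  refine Mz.cover (Fin n → Bool) inferInstance (fun σ => GF.lift (GF.psub b ε σ))
    (fun _ => box (n + 1) 1) (fun _ => box_compact 1) (fun σ => (an_cont (hlan σ)).continuousOn) ?_
    (fun σ y _ _ => hlan σ y) (fun σ y _ hy => ?_)
  · have hsmall : ∀ᶠ y : Fin (n + 1) → ℝ in 𝓝 (cn 0 b), ∀ i, |y i - cn 0 b i| < 1 := by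
      rw [eventually_all]
      intro i
      have : Continuous fun x : Fin (n + 1) → ℝ => |x i - cn 0 b i| := by fun_prop
      refine (this.tendsto _).eventually (gt_mem_nhds ?_)
      simp
    filter_upwards [hsmall] with y hy
    choose s v hv1 hv2 using fun j : Fin n => root_cover (ε j) (hε j) (y j.succ - b j)
      (by simpa using (hy j.succ).le)
    rw [Set.mem_iUnion]
    refine ⟨s, cn (y 0) v, ?_, ?_⟩
    · rw [mem_box]
      intro i
      refine Fin.cases ?_ (fun j => ?_) i
      · simpa using (hy 0).le
      · exact hv1 j
    · simp only [GF.lift, cn_zero, tl_cn]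
      have : GF.psub b ε s v = GF.tl y := by
        ext j; simp [GF.psub, hv2]
      rw [this, cn_tl]
  · obtain ⟨h1, h2⟩ := cn_inj hy
    rw [psub_eq hε] at h2
    have : y = 0 := by
      ext i
      refine Fin.cases ?_ (fun j => ?_) i
      · exact h1
      · exact congrFun h2 j
    rw [this]; exact h σ

lemma leaf {d : ℕ} (hd : 1 ≤ d) (IH : SD n d) {b : Fin n → ℝ} {u : (Fin (n + 1) → ℝ) → ℝ}
    (hu : AnalyticAt ℝ u (cn 0 b)) (hu0 : u (cn 0 b) ≠ 0) {c : ℕ → (Fin n → ℝ) → ℝ}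
    (hc0 : ∀ i < d - 1, c i b = 0)
    (hc : ∀ i < d - 1, (∀ᶠ x in 𝓝 b, c i x = 0) ∨ NC (c i) b)
    (hcd : ∀ i < d - 1, ∀ k < d - 1, (∀ᶠ x in 𝓝 b, c i x ^ (d - k) - c k x ^ (d - i) = 0) ∨
      NC (fun x => c i x ^ (d - k) - c k x ^ (d - i)) b)
    {g : (Fin n → ℝ) → ℝ} (hg : NC g b) {G : (Fin (n + 1) → ℝ) → ℝ}
    (hG : ∀ᶠ y in 𝓝 (cn 0 b), G y = (y 0 ^ d * u y + ∑ i ∈ Finset.range (d - 1),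
      c i (tl y) * y 0 ^ i) * g (tl y)) : Mz G (cn 0 b) := by
  classical
  set I := (Finset.range (d - 1)).filter (fun i => ¬ ∀ᶠ x in 𝓝 b, c i x = 0) with hI
  have hIlt : ∀ i ∈ I, i < d - 1 := fun i hi => Finset.mem_range.1 (Finset.mem_filter.1 hi).1
  have hIz : ∀ i < d - 1, i ∉ I → ∀ᶠ x in 𝓝 b, c i x = 0 := by
    intro i hi hiI
    by_contra hcon
    exact hiI (Finset.mem_filter.2 ⟨Finset.mem_range.2 hi, hcon⟩)
  rcases I.eq_empty_or_nonempty with hIe | hIne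
  · -- all coefficients vanish
    have hz : ∀ᶠ y in 𝓝 (cn 0 b), ∀ i ∈ Finset.range (d - 1), c i (tl y) = 0 := by
      rw [Finset.eventually_all]
      intro i hi
      exact (tl_cont.tendsto (cn 0 b)).eventually
        (hIz i (Finset.mem_range.1 hi) (by simp [hIe]))
    refine Mz.nc (((((NC.coord 0 (cn 0 b)).pow d).mul (NC.unit hu hu0)).mul
      (NC.tl (y := cn 0 b) hg)).congr ?_)
    filter_upwards [hG, hz] with y h1 h2
    rw [h1, Finset.sum_eq_zero, add_zero]
    intro i hi
    rw [h2 i hi, zero_mul]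
  -- exponents
  have hex : ∀ i, ∃ (α : Fin n → ℕ) (U : (Fin n → ℝ) → ℝ), i ∈ I → (AnalyticAt ℝ U b ∧ U b ≠ 0 ∧
      ∀ᶠ x in 𝓝 b, c i x = (∏ j, (x j - b j) ^ α j) * U x) := by
    intro i
    by_cases hi : i ∈ I
    · obtain ⟨α, U, h⟩ := (hc i (hIlt i hi)).resolve_left (Finset.mem_filter.1 hi).2
      exact ⟨α, U, fun _ => h⟩
    · exact ⟨fun _ => 0, fun _ => 0, fun h => absurd h hi⟩
  choose α U hαU using hex
  have hcmp : ∀ i ∈ I, ∀ k ∈ I, (∀ j, (d - k) * α i j ≤ (d - i) * α k j) ∨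
      (∀ j, (d - i) * α k j ≤ (d - k) * α i j) := by
    intro i hi k hk
    obtain ⟨h1, h2, h3⟩ := hαU i hi
    obtain ⟨h1', h2', h3'⟩ := hαU k hk
    refine comparable (b := b) (α := fun j => (d - k) * α i j) (β := fun j => (d - i) * α k j)
      (f := fun x => c i x ^ (d - k)) (g := fun x => c k x ^ (d - i))
      (u := fun x => U i x ^ (d - k)) (v := fun x => U k x ^ (d - i))
      (h1.fun_pow _) (pow_ne_zero _ h2) (h1'.fun_pow _) (pow_ne_zero _ h2') ?_ ?_
      (hcd i (hIlt i hi) k (hIlt k hk))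
    · filter_upwards [h3] with x hx
      rw [hx, mul_pow, ← Finset.prod_pow]
      congr 1
      refine Finset.prod_congr rfl fun j _ => ?_
      rw [← pow_mul, mul_comm]
    · filter_upwards [h3'] with x hx
      rw [hx, mul_pow, ← Finset.prod_pow]
      congr 1
      refine Finset.prod_congr rfl fun j _ => ?_
      rw [← pow_mul, mul_comm]
  obtain ⟨k, hkI, hkmin⟩ := I.exists_min_image
    (fun i => ((∑ j, α i j : ℕ) : ℚ) / ((d - i : ℕ) : ℚ)) hIne
  have hle : ∀ i ∈ I, ∀ j, (d - i) * α k j ≤ (d - k) * α i j := by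
    intro i hi
    rcases hcmp i hi k hkI with h | h
    · have h1 := hkmin i hi
      have hik := hIlt i hi
      have hkk := hIlt k hkI
      have p1 : (0 : ℚ) < ((d - i : ℕ) : ℚ) := by
        have : 0 < d - i := by omega
        exact_mod_cast this
      have p2 : (0 : ℚ) < ((d - k : ℕ) : ℚ) := by
        have : 0 < d - k := by omega
        exact_mod_cast this
      rw [div_le_div_iff₀ p2 p1] at h1
      have h2 : (∑ j, α k j) * (d - i) ≤ (∑ j, α i j) * (d - k) := by exact_mod_cast h1
      have h3 : ∑ j, (d - i) * α k j ≤ ∑ j, (d - k) * α i j := by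
        rw [← Finset.mul_sum, ← Finset.mul_sum]; linarith
      have h4 : ∑ j, (d - k) * α i j = ∑ j, (d - i) * α k j :=
        le_antisymm (Finset.sum_le_sum fun j _ => h j) h3
      have h5 := (Finset.sum_eq_sum_iff_of_le (fun j _ => h j)).1 h4
      intro j
      exact (h5 j (Finset.mem_univ j)).ge
    · exact h
  have hkk := hIlt k hkI
  set S : Finset (Fin n) := Finset.univ.filter (fun j => 0 < α k j) with hSdef
  have hSne : S.Nonempty := by
    by_contra hcon
    rw [Finset.not_nonempty_iff_eq_empty, Finset.filter_eq_empty_iff] at hcon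
    have h1 : ∀ i, α k i = 0 := fun i => by have := hcon (Finset.mem_univ i); omega
    obtain ⟨_, h2, h3⟩ := hαU k hkI
    have := h3.self_of_nhds
    rw [hc0 k hkk] at this
    simp [h1] at this
    exact h2 this.symm
  have hS0 : ∀ j, j ∉ S → α k j = 0 := by
    intro j hj
    by_contra hcon
    exact hj (Finset.mem_filter.2 ⟨Finset.mem_univ j, Nat.pos_of_ne_zero hcon⟩)
  have hSp : ∀ j ∈ S, 0 < α k j := fun j hj => (Finset.mem_filter.1 hj).2
  set B := ∏ l ∈ S, α k l with hBdef
  have hB : 1 ≤ B := Nat.one_le_iff_ne_zero.2 (Finset.prod_ne_zero_iff.2 fun j hj => (hSp j hj).ne')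
  have hdiv : ∀ j ∈ S, B / α k j * α k j = B := fun j hj =>
    Nat.div_mul_cancel (Finset.dvd_prod_of_mem _ hj)
  set ε : Fin n → ℕ := fun j => if j ∈ S then (d - k) * (B / α k j) else 1 with hεdef
  have hε : ∀ j, 1 ≤ ε j := by
    intro j
    by_cases hj : j ∈ S
    · simp only [hεdef, hj, if_true]
      have h1 : 0 < B / α k j := by
        rcases Nat.eq_zero_or_pos (B / α k j) with h | h
        · have := hdiv j hj; rw [h] at this; omega
        · exact h
      have h2 : 0 < d - k := by omega
      exact Nat.mul_pos h2 h1
    · simp [hεdef, hj]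
  set M : ℕ → Fin n → ℕ := fun i j => if j ∈ S then B * (d - i) else 0 with hMdef
  have hexp : ∀ i ∈ I, ∀ j, M i j ≤ ε j * α i j := by
    intro i hi j
    by_cases hj : j ∈ S
    · simp only [hεdef, hMdef, hj, if_true]
      calc B * (d - i) = (B / α k j * α k j) * (d - i) := by rw [hdiv j hj]
        _ = (B / α k j) * ((d - i) * α k j) := by ring
        _ ≤ (B / α k j) * ((d - k) * α i j) := Nat.mul_le_mul_left _ (hle i hi j)
        _ = _ := by ring
    · simp [hMdef, hj]
  have hexpk : ∀ j, ε j * α k j = M k j := by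
    intro j
    by_cases hj : j ∈ S
    · simp only [hεdef, hMdef, hj, if_true]
      calc (d - k) * (B / α k j) * α k j = (d - k) * (B / α k j * α k j) := by ring
        _ = B * (d - k) := by rw [hdiv j hj]; ring
    · simp [hMdef, hj, hS0 j hj]
  have hPM : ∀ i (y : Fin n → ℝ), ∏ j, y j ^ M i j = PP S y ^ (B * (d - i)) := by
    intro i y
    rw [PP, ← Finset.prod_pow]
    simp only [hMdef]
    rw [← Finset.prod_subset (Finset.subset_univ S)]
    · exact Finset.prod_congr rfl fun j hj => by rw [if_pos hj]
    · intro j _ hj; rw [if_neg hj, pow_zero]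
  refine Mz.psub hε fun σ => ?_
  have hψan := psub_analytic b ε σ 0
  have hψ0 : psub b ε σ 0 = b := (psub_eq hε).2 rfl
  have hψt : Tendsto (psub b ε σ) (𝓝 0) (𝓝 b) := by
    have := hψan.continuousAt.tendsto
    rwa [hψ0] at this
  have htl0 : tl (0 : Fin (n + 1) → ℝ) = 0 := rfl
  have hl0 : lift (psub b ε σ) 0 = cn 0 b := by
    rw [lift, htl0, hψ0]; rfl
  have hlan : AnalyticAt ℝ (lift (psub b ε σ)) 0 := lift_analytic (by rw [htl0]; exact hψan)
  have hlt : Tendsto (lift (psub b ε σ)) (𝓝 0) (𝓝 (cn 0 b)) := by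
    have := hlan.continuousAt.tendsto
    rwa [hl0] at this
  have hmon : ∀ (γ : Fin n → ℕ) (y : Fin n → ℝ), ∏ j, (psub b ε σ y j - b j) ^ γ j =
      ∏ j, (sg (σ j) ^ γ j * y j ^ (ε j * γ j)) := by
    intro γ y
    refine Finset.prod_congr rfl fun j _ => ?_
    simp only [psub, add_sub_cancel_left, mul_pow, pow_mul]
  set e : ℕ → (Fin n → ℝ) → ℝ := fun i => if i ∈ I then fun y =>
    (∏ j, (sg (σ j) ^ α i j * y j ^ (ε j * α i j - M i j))) * U i (psub b ε σ y) else fun _ => 0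
    with hedef
  have hgnc : NC (fun y => g (psub b ε σ y)) 0 := by
    obtain ⟨γ, v, hv, hv0, hge⟩ := hg
    have h1 : NC (fun y => (∏ j, (sg (σ j) ^ γ j * y j ^ (ε j * γ j))) * v (psub b ε σ y))
        (0 : Fin n → ℝ) := by
      refine NC.mul (NC.prod _ fun j _ => NC.mul (NC.unit analyticAt_const
        (pow_ne_zero _ (sg_ne _))) ((NC.coord j _).pow _)) (NC.unit ?_ ?_)
      · exact AnalyticAt.fun_comp (by rw [hψ0]; exact hv) hψan
      · rw [hψ0]; exact hv0
    refine h1.congr ?_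
    filter_upwards [hψt.eventually hge] with y hy
    rw [hy, hmon]
  refine leaf2 IH S hSne B hB (u := u ∘ lift (psub b ε σ)) (e := e) (k := k)
    (AnalyticAt.comp (by rw [hl0]; exact hu) hlan) (by simpa [hl0] using hu0) ?_ (by omega) ?_
    hgnc ?_
  · intro i _
    by_cases hi : i ∈ I
    · simp only [hedef, hi, if_true]
      refine AnalyticAt.fun_mul (Finset.analyticAt_fun_prod _ fun j _ =>
        analyticAt_const.fun_mul ((analyticAt_coord j _).fun_pow _)) ?_
      exact AnalyticAt.fun_comp (by rw [hψ0]; exact (hαU i hi).1) hψan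
    · simp only [hedef, hi, if_false]; exact analyticAt_const
  · simp only [hedef, hkI, if_true, hexpk, Nat.sub_self, pow_zero, mul_one, hψ0]
    exact mul_ne_zero (Finset.prod_ne_zero_iff.2 fun j _ => pow_ne_zero _ (sg_ne _)) (hαU k hkI).2.1
  · have hce : ∀ᶠ y in 𝓝 (0 : Fin (n + 1) → ℝ), ∀ i ∈ Finset.range (d - 1),
        c i (psub b ε σ (tl y)) = PP S (tl y) ^ (B * (d - i)) * e i (tl y) := by
      rw [Finset.eventually_all]
      intro i hi
      have hi := Finset.mem_range.1 hi
      have : Tendsto (fun y : Fin (n + 1) → ℝ => psub b ε σ (tl y)) (𝓝 0) (𝓝 b) :=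
        hψt.comp (tl_cont.tendsto 0)
      by_cases hiI : i ∈ I
      · filter_upwards [this.eventually (hαU i hiI).2.2] with y hy
        rw [hy, hmon, ← hPM]
        simp only [hedef, hiI, if_true]
        rw [← mul_assoc, ← Finset.prod_mul_distrib]
        congr 1
        refine Finset.prod_congr rfl fun j _ => ?_
        rw [mul_left_comm, ← pow_add, Nat.add_sub_cancel' (hexp i hiI j)]
      · filter_upwards [this.eventually (hIz i hi hiI)] with y hy
        rw [hy]; simp [hedef, hiI]
    filter_upwards [hlt.eventually hG, hce] with y h1 h2
    simp only [Function.comp, h1]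
    have e1 : tl (lift (psub b ε σ) y) = psub b ε σ (tl y) := rfl
    have e2 : lift (psub b ε σ) y 0 = y 0 := rfl
    rw [e1, e2]
    congr 2
    exact Finset.sum_congr rfl fun i hi => by rw [h2 i hi]
end
end GF

namespace GF

section
variable {n : ℕ}

lemma shift_analytic {φ : (Fin n → ℝ) → ℝ} {y : Fin (n + 1) → ℝ} (h : AnalyticAt ℝ φ (tl y)) :
    AnalyticAt ℝ (shift φ) y :=
  cn_analytic ((h.fun_comp (tl_analytic y)).fun_add (analyticAt_coord 0 y)) (tl_analytic y)

lemma Mz.shift {φ : (Fin n → ℝ) → ℝ} {a : Fin n → ℝ} (h : AnalyticAt ℝ φ a)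
    {G : (Fin (n + 1) → ℝ) → ℝ} (hG : Mz (G ∘ GF.shift φ) (cn 0 a)) : Mz G (cn (φ a) a) := by
  obtain ⟨r, hr, hball⟩ := Metric.eventually_nhds_iff_ball.1 h.eventually_analyticAt
  have hb : ∀ x ∈ Metric.closedBall a (r / 2), AnalyticAt ℝ φ x := fun x hx =>
    hball x (Metric.closedBall_subset_ball (by linarith) hx)
  have key : ∀ y, GF.shift φ y = cn (φ a) a → y = cn 0 a := by
    intro y hy
    obtain ⟨h1, h2⟩ := cn_inj hy
    rw [h2, add_eq_left] at h1
    rw [← cn_tl y, h1, h2]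
  refine Mz.chart (GF.shift φ) {y | y 0 ∈ Set.Icc (-1) 1 ∧ tl y ∈ Metric.closedBall a (r / 2)}
    (compact_cyl (isCompact_closedBall _ _) _ _) ?_ ?_ ?_ ?_
  · intro y hy
    exact (shift_analytic (hb _ hy.2)).continuousAt.continuousWithinAt
  · have h1 : ∀ᶠ y : Fin (n + 1) → ℝ in 𝓝 (cn (φ a) a), tl y ∈ Metric.closedBall a (r / 2) :=
      (tl_cont.tendsto (cn (φ a) a)).eventually
        (Metric.closedBall_mem_nhds _ (by linarith))
    have h2 : ∀ᶠ y : Fin (n + 1) → ℝ in 𝓝 (cn (φ a) a), y 0 - φ (tl y) ∈ Set.Icc (-1 : ℝ) 1 := by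
      have hc : ContinuousAt (fun y : Fin (n + 1) → ℝ => y 0 - φ (tl y)) (cn (φ a) a) :=
        (continuous_apply 0).continuousAt.sub
          (ContinuousAt.comp (g := φ) (f := tl) h.continuousAt tl_cont.continuousAt)
      refine hc.tendsto.eventually ?_
      simp only [cn_zero, tl_cn, sub_self]
      exact Icc_mem_nhds (by norm_num) (by norm_num)
    filter_upwards [h1, h2] with y h1 h2
    refine ⟨cn (y 0 - φ (tl y)) (tl y), ⟨h2, h1⟩, ?_⟩
    simp [GF.shift]
  · intro y hy _
    exact shift_analytic (hb _ hy.2)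
  · intro y _ hya
    rw [key y hya]; exact hG

lemma SD_succ (hM : Mon n) {d : ℕ} (IH : SD n d) : SD n (d + 1) := by
  intro F g y hF hg hg0 hex
  by_cases hlow : ∃ j < d, pd^[j] F y ≠ 0
  · exact IH F g y hF hg hg0 hlow
  push Not at hlow
  obtain ⟨j, hj, hj0⟩ := hex
  have hjd : j = d := by
    by_contra hne
    exact hj0 (hlow j (by omega))
  subst hjd
  obtain ⟨s, a, rfl⟩ : ∃ s a, y = cn s a := ⟨y 0, tl y, (cn_tl y).symm⟩
  rw [tl_cn] at hg hg0
  rcases Nat.eq_zero_or_pos j with hd | hd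
  · -- unit
    subst hd
    refine (hM g a hg hg0).lift _ s fun ψ b hb hψ hnc => Mz.nc ?_
    have hl : lift ψ (cn s b) = cn s a := by simp [lift, hb]
    refine NC.mul (f := F ∘ lift ψ) (g := fun y => (g ∘ ψ) (tl y)) (NC.unit ?_ ?_) (NC.tl hnc)
    · exact AnalyticAt.comp (by rw [hl]; exact hF) (lift_analytic (by simpa using hψ))
    · simpa [hl] using hj0
  obtain ⟨φ, hφ, hφa, hφz⟩ := implicit (G := pd^[j - 1] F) (pd_iter_analytic hF (j - 1))
    (hlow (j - 1) (by omega)) (by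
      rw [← Function.iterate_succ_apply' pd (j - 1) F]
      rwa [Nat.succ_eq_add_one, Nat.sub_add_cancel hd])
  have hgoal : Mz (fun y => F y * g (tl y)) (cn (φ a) a) := by
    refine Mz.shift hφ ?_
    have hs0 : shift φ (cn 0 a) = cn s a := by simp [shift, hφa]
    have hF' : AnalyticAt ℝ (F ∘ shift φ) (cn 0 a) :=
      AnalyticAt.comp (by rw [hs0]; exact hF) (shift_analytic (by simpa using hφ))
    obtain ⟨u, hu, hue, hud⟩ := taylor j hF'
    have hu0 : u (cn 0 a) ≠ 0 := by
      intro h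
      rw [h, mul_zero, pd_shift, hs0] at hud
      exact hj0 hud
    set c : ℕ → (Fin n → ℝ) → ℝ := fun i x => pd^[i] (F ∘ shift φ) (cn 0 x) / (i.factorial : ℝ)
      with hc
    have hcan : ∀ i, AnalyticAt ℝ (c i) a := by
      intro i
      refine AnalyticAt.fun_div ?_ analyticAt_const (by positivity)
      exact AnalyticAt.fun_comp (g := pd^[i] (F ∘ shift φ)) (f := fun x => cn 0 x)
        (pd_iter_analytic hF' i) (cn_analytic analyticAt_const analyticAt_id)
    have hc0 : ∀ i < j, c i a = 0 := by
      intro i hi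
      simp only [hc, pd_shift, hs0, hlow i hi, zero_div]
    have hclast : ∀ᶠ x in 𝓝 a, c (j - 1) x = 0 := by
      filter_upwards [hφz] with x hx
      simp only [hc, pd_shift, shift, tl_cn, cn_zero, add_zero, hx, zero_div]
    have hue' : ∀ᶠ y in 𝓝 (cn 0 a), F (shift φ y) =
        y 0 ^ j * u y + ∑ i ∈ Finset.range (j - 1), c i (tl y) * y 0 ^ i := by
      filter_upwards [hue, (tl_cont.tendsto (cn 0 a)).eventually hclast] with y h1 h2
      have h3 : F (shift φ y) = ∑ i ∈ Finset.range j, c i (tl y) * y 0 ^ i + y 0 ^ j * u y := h1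
      have h4 : ∑ i ∈ Finset.range j, c i (tl y) * y 0 ^ i =
          ∑ i ∈ Finset.range (j - 1), c i (tl y) * y 0 ^ i := by
        conv_lhs => rw [show j = (j - 1) + 1 by omega]
        rw [Finset.sum_range_succ, h2, zero_mul, add_zero]
      rw [h3, h4, add_comm]
    let H : Option (Fin j ⊕ Fin j × Fin j) → (Fin n → ℝ) → ℝ := fun o => match o with
      | none => g
      | some (.inl i) => c i
      | some (.inr (i, k)) => fun x => c i x ^ (j - k) - c k x ^ (j - i)
    refine multi hM Finset.univ H (fun o _ => ?_) _ 0 fun ψ b hb hψ hnc => ?_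
    · rcases o with _ | i | ⟨i, k⟩
      · exact hg
      · exact hcan i
      · exact ((hcan i).fun_pow _).fun_sub ((hcan k).fun_pow _)
    have hl : lift ψ (cn 0 b) = cn 0 a := by simp [lift, hb]
    have hlan : AnalyticAt ℝ (lift ψ) (cn 0 b) := lift_analytic (by simpa using hψ)
    have hlt : Tendsto (lift ψ) (𝓝 (cn 0 b)) (𝓝 (cn 0 a)) := by
      have := hlan.continuousAt.tendsto
      rwa [hl] at this
    refine leaf hd IH (u := u ∘ lift ψ) (c := fun i x => c i (ψ x)) (g := fun x => g (ψ x))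
      (AnalyticAt.comp (by rw [hl]; exact hu) hlan) (by simpa [hl] using hu0)
      (fun i hi => by rw [hb]; exact hc0 i (by omega)) (fun i hi => ?_) (fun i hi k hk => ?_) ?_ ?_
    · exact (hnc (some (.inl ⟨i, by omega⟩)) (Finset.mem_univ _)).imp (fun h => h.2) id
    · exact (hnc (some (.inr (⟨i, by omega⟩, ⟨k, by omega⟩))) (Finset.mem_univ _)).imp
        (fun h => h.2) id
    · exact (hnc none (Finset.mem_univ _)).resolve_left fun h => hg0 h.1
    · filter_upwards [hlt.eventually hue'] with y hy
      simp only [Function.comp]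
      rw [hy]
      rfl
  rw [hφa] at hgoal
  exact hgoal

lemma SD_all (hM : Mon n) (d : ℕ) : SD n d := by
  induction d with
  | zero => intro F g y _ _ _ h; obtain ⟨j, hj, _⟩ := h; omega
  | succ d ih => exact SD_succ hM ih

lemma zero_of_iter {h : ℝ → ℝ} {t : ℝ} (hh : AnalyticAt ℝ h t) (h0 : ∀ j, iteratedDeriv j h t = 0) :
    ∀ᶠ s in 𝓝 t, h s = 0 := by
  have := hh.hasFPowerSeriesAt
  have hz : (FormalMultilinearSeries.ofScalars ℝ fun n => iteratedDeriv n h t / (n.factorial : ℝ))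
      = 0 := by
    ext m
    simp [FormalMultilinearSeries.ofScalars, h0]
  rw [hz] at this
  exact this.eventually_eq_zero

lemma exists_line {f : (Fin n → ℝ) → ℝ} {a : Fin n → ℝ} (hf : AnalyticAt ℝ f a)
    (h0 : ¬ ∀ᶠ x in 𝓝 a, f x = 0) : ∃ v : Fin n → ℝ, ¬ ∀ᶠ t in 𝓝 (0 : ℝ), f (a + t • v) = 0 := by
  obtain ⟨r, hr, hball⟩ := Metric.eventually_nhds_iff_ball.1 hf.eventually_analyticAt
  have : ∃ x ∈ Metric.ball a r, f x ≠ 0 := by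
    by_contra hcon
    push Not at hcon
    exact h0 (Filter.mem_of_superset (Metric.ball_mem_nhds a hr) hcon)
  obtain ⟨x, hx, hfx⟩ := this
  refine ⟨x - a, fun hev => hfx ?_⟩
  have han : AnalyticOnNhd ℝ (fun t : ℝ => f (a + t • (x - a))) (Set.Icc 0 1) := by
    intro t ht
    have hin : a + t • (x - a) ∈ Metric.ball a r := by
      rw [Metric.mem_ball, dist_eq_norm] at hx ⊢
      rw [add_sub_cancel_left, norm_smul, Real.norm_eq_abs, abs_of_nonneg ht.1]
      calc t * ‖x - a‖ ≤ 1 * ‖x - a‖ := by gcongr; exact ht.2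
        _ < r := by rwa [one_mul]
    exact AnalyticAt.fun_comp (g := f) (f := fun t : ℝ => a + t • (x - a)) (hball _ hin)
      (analyticAt_const.fun_add (analyticAt_id.fun_smul analyticAt_const))
  have := han.eqOn_zero_of_preconnected_of_eventuallyEq_zero isPreconnected_Icc
    (Set.left_mem_Icc.2 zero_le_one) hev (Set.right_mem_Icc.2 zero_le_one)
  simpa using this

lemma Mon_succ (hM : Mon n) : Mon (n + 1) := by
  intro f a hf h0
  by_cases hfa : f a ≠ 0
  · exact Mz.nc (NC.unit hf hfa)
  push Not at hfa
  obtain ⟨v, hv⟩ := exists_line hf h0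
  have hv0 : v ≠ 0 := by
    rintro rfl
    exact hv (by simp [hfa])
  have he0 : (Pi.single 0 1 : Fin (n + 1) → ℝ) ≠ 0 := by simp
  obtain ⟨L, hL⟩ := SeparatingDual.exists_continuousLinearEquiv_apply_eq (R := ℝ) he0 hv0
  have hφan : ∀ y, AnalyticAt ℝ (fun y => a + L y) y := fun y =>
    analyticAt_const.fun_add ((L : (Fin (n + 1) → ℝ) →L[ℝ] (Fin (n + 1) → ℝ)).analyticAt y)
  refine Mz.chart (fun y => a + L y) (Metric.closedBall 0 1) (isCompact_closedBall _ _)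
    (an_cont hφan).continuousOn ?_ (fun b _ _ => hφan b) ?_
  · have hc : Continuous fun x => L.symm (x - a) := by fun_prop
    have : ∀ᶠ x in 𝓝 a, L.symm (x - a) ∈ Metric.closedBall (0 : Fin (n + 1) → ℝ) 1 := by
      refine (hc.tendsto a).eventually ?_
      simp only [sub_self, map_zero]
      exact Metric.closedBall_mem_nhds _ one_pos
    filter_upwards [this] with x hx
    exact ⟨_, hx, by simp⟩
  · intro b _ hb
    have hb0 : b = 0 := by
      rw [add_eq_left] at hb
      simpa using hb
    subst hb0
    have hFan : AnalyticAt ℝ (f ∘ fun y => a + L y) 0 :=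
      AnalyticAt.comp (by simpa using hf) (hφan 0)
    have hz : (0 : Fin (n + 1) → ℝ) = cn 0 0 := by
      ext i; refine Fin.cases ?_ (fun j => ?_) i <;> simp
    have hslice : ∀ t : ℝ, (f ∘ fun y => a + L y) (cn t 0) = f (a + t • v) := by
      intro t
      have : (cn t 0 : Fin (n + 1) → ℝ) = t • Pi.single 0 1 := by
        ext i; refine Fin.cases ?_ (fun j => ?_) i <;> simp
      simp [this, hL]
    have hex : ∃ j, pd^[j] (f ∘ fun y => a + L y) 0 ≠ 0 := by
      by_contra hcon
      push Not at hcon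
      refine hv (zero_of_iter (h := fun t => f (a + t • v)) ?_ fun j => ?_)
      · exact AnalyticAt.fun_comp (g := f) (f := fun t : ℝ => a + t • v) (by simpa using hf)
          (analyticAt_const.fun_add (analyticAt_id.fun_smul analyticAt_const))
      · have := hcon j
        rw [hz, pd_iter] at this
        simpa only [hslice] using this
    obtain ⟨j, hj⟩ := hex
    have := SD_all hM (j + 1) (f ∘ fun y => a + L y) (fun _ => 1) 0 hFan analyticAt_const
      (fun h => one_ne_zero h.self_of_nhds) ⟨j, by omega, hj⟩
    simp only [mul_one] at this
    exact this

lemma Mon_all (n : ℕ) : Mon n := by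
  induction n with
  | zero =>
    intro f a hf h0
    refine Mz.nc (NC.unit hf fun h => h0 (Eventually.of_forall fun x => ?_))
    rwa [Subsingleton.elim x a]
  | succ n ih => exact Mon_succ ih

/-- Lojasiewicz gradient inequality -/
theorem loj_pi {f : (Fin n → ℝ) → ℝ} {a : Fin n → ℝ} (hf : AnalyticAt ℝ f a) (h0 : f a = 0) :
    Lset f a Set.univ := by
  by_cases h : ∀ᶠ x in 𝓝 a, f x = 0
  · refine ⟨1/2, ⟨by norm_num, by norm_num⟩, 1, one_pos, ?_⟩
    filter_upwards [h] with x hx _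
    rw [hx, abs_zero, Real.zero_rpow (by norm_num), mul_zero]
    positivity
  · exact (Mon_all n f a hf h).loj hf h0

end
end GF

namespace GF

theorem scal_pos {g v : ℝ → ℝ} {a b c θ : ℝ} (hab : a ≤ b) (hc : 0 < c) (hθ : θ ∈ Set.Ioo (0:ℝ) 1)
    (hv : Continuous v)
    (hg : ∀ t ∈ Set.Icc a b, HasDerivAt g (-(v t) ^ 2) t)
    (hgb : 0 ≤ g b) (hpos : ∀ t ∈ Set.Ioo a b, 0 < g t)
    (hL : ∀ t ∈ Set.Icc a b, c * (g t) ^ θ ≤ v t) :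
    ∫ s in a..b, v s ≤ (1 / (c * (1 - θ))) * (g a) ^ (1 - θ) := by
  have h1 : 0 < 1 - θ := by linarith [hθ.2]
  have hFd : ∀ t, HasDerivAt (fun u => ∫ s in a..u, v s) (v t) t := fun t =>
    (hv.integral_hasStrictDerivAt a t).hasDerivAt
  set F : ℝ → ℝ := fun t => (1 / (c * (1 - θ))) * (g t) ^ (1 - θ) + ∫ s in a..t, v s with hF
  have hder : ∀ t ∈ Set.Ioo a b, HasDerivAt F
      ((1 / (c * (1 - θ))) * (-(v t) ^ 2 * (1 - θ) * (g t) ^ (1 - θ - 1)) + v t) t := by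
    intro t ht
    have := (hg t ⟨ht.1.le, ht.2.le⟩).rpow_const (p := 1 - θ) (Or.inl (hpos t ht).ne')
    exact (this.const_mul _).add (hFd t)
  have hanti : AntitoneOn F (Set.Icc a b) := by
    apply antitoneOn_of_deriv_nonpos (convex_Icc a b)
    · apply ContinuousOn.add
      · apply ContinuousOn.mul continuousOn_const
        apply ContinuousOn.rpow_const
        · exact fun t ht => (hg t ht).continuousAt.continuousWithinAt
        · exact fun t _ => Or.inr h1.le
      · exact fun t _ => (hFd t).continuousAt.continuousWithinAt
    · rw [interior_Icc]
      exact fun t ht => (hder t ht).differentiableAt.differentiableWithinAt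
    · rw [interior_Icc]
      intro t ht
      rw [(hder t ht).deriv]
      have hp := hpos t ht
      have hl := hL t ⟨ht.1.le, ht.2.le⟩
      have e1 : (g t) ^ (1 - θ - 1) = ((g t) ^ θ)⁻¹ := by
        rw [show 1 - θ - 1 = -θ by ring, Real.rpow_neg hp.le]
      have hq : 0 < (g t) ^ θ := Real.rpow_pos_of_pos hp θ
      rw [e1]
      set q := (g t) ^ θ
      have hvp : 0 < v t := lt_of_lt_of_le (by positivity) hl
      have e2 : (1 / (c * (1 - θ))) * (-(v t) ^ 2 * (1 - θ) * q⁻¹) + v t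
          = v t * (c * q - v t) / (c * q) := by
        field_simp
        ring
      rw [e2]
      apply div_nonpos_of_nonpos_of_nonneg _ (by positivity)
      exact mul_nonpos_of_nonneg_of_nonpos hvp.le (by linarith)
  have := hanti (Set.left_mem_Icc.2 hab) (Set.right_mem_Icc.2 hab) hab
  simp only [hF, intervalIntegral.integral_same, add_zero] at this
  have h2 : 0 ≤ (1 / (c * (1 - θ))) * (g b) ^ (1 - θ) := by positivity
  linarith

theorem scal {g v : ℝ → ℝ} {a b c θ : ℝ} (hab : a ≤ b) (hc : 0 < c) (hθ : θ ∈ Set.Ioo (0:ℝ) 1)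
    (hv : Continuous v)
    (hg : ∀ t ∈ Set.Icc a b, HasDerivAt g (-(v t) ^ 2) t)
    (hg0 : ∀ t ∈ Set.Icc a b, 0 ≤ g t)
    (hz : ∀ t ∈ Set.Icc a b, g t = 0 → v t = 0)
    (hL : ∀ t ∈ Set.Icc a b, c * (g t) ^ θ ≤ v t) :
    ∫ s in a..b, v s ≤ (1 / (c * (1 - θ))) * (g a) ^ (1 - θ) := by
  have hgc : ContinuousOn g (Set.Icc a b) := fun t ht =>
    (hg t ht).continuousAt.continuousWithinAt
  have hanti : AntitoneOn g (Set.Icc a b) := by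
    apply antitoneOn_of_deriv_nonpos (convex_Icc a b) hgc
    · rw [interior_Icc]
      exact fun t ht => (hg t ⟨ht.1.le, ht.2.le⟩).differentiableAt.differentiableWithinAt
    · rw [interior_Icc]
      intro t ht
      rw [(hg t ⟨ht.1.le, ht.2.le⟩).deriv]
      nlinarith [sq_nonneg (v t)]
  by_cases hne : (Set.Icc a b ∩ g ⁻¹' {0}).Nonempty
  · have hcl : IsClosed (Set.Icc a b ∩ g ⁻¹' {0}) :=
      hgc.preimage_isClosed_of_isClosed isClosed_Icc isClosed_singleton
    have hcomp : IsCompact (Set.Icc a b ∩ g ⁻¹' {0}) :=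
      isCompact_Icc.of_isClosed_subset hcl Set.inter_subset_left
    obtain ⟨t0, ⟨ht0, hgt0⟩, hmin⟩ := hcomp.exists_isLeast hne
    have hgt0 : g t0 = 0 := hgt0
    have h1 : ∫ s in a..t0, v s ≤ (1 / (c * (1 - θ))) * (g a) ^ (1 - θ) := by
      apply scal_pos ht0.1 hc hθ hv
      · exact fun t ht => hg t ⟨ht.1, ht.2.trans ht0.2⟩
      · exact hgt0.ge
      · intro t ht
        have hm : t ∈ Set.Icc a b := ⟨ht.1.le, ht.2.le.trans ht0.2⟩
        rcases (hg0 t hm).lt_or_eq with h | h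
        · exact h
        · exact absurd (hmin ⟨hm, h.symm⟩) (not_le.2 ht.2)
      · exact fun t ht => hL t ⟨ht.1, ht.2.trans ht0.2⟩
    have h2 : ∫ s in t0..b, v s = 0 := by
      rw [intervalIntegral.integral_congr (g := fun _ => (0:ℝ))]
      · simp
      · intro t ht
        rw [Set.uIcc_of_le ht0.2] at ht
        have hm : t ∈ Set.Icc a b := ⟨ht0.1.trans ht.1, ht.2⟩
        apply hz t hm
        apply le_antisymm _ (hg0 t hm)
        rw [← hgt0]
        exact hanti ht0 hm ht.1
    rw [← intervalIntegral.integral_add_adjacent_intervals (hv.intervalIntegrable a t0)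
      (hv.intervalIntegrable t0 b), h2, add_zero]
    exact h1
  · apply scal_pos hab hc hθ hv hg (hg0 b (Set.right_mem_Icc.2 hab)) _ hL
    intro t ht
    have hm : t ∈ Set.Icc a b := ⟨ht.1.le, ht.2.le⟩
    rcases (hg0 t hm).lt_or_eq with h | h
    · exact h
    · exact absurd ⟨t, hm, h.symm⟩ hne

theorem norm_grad {E : Type*} [NormedAddCommGroup E] [InnerProductSpace ℝ E] [CompleteSpace E]
    (f : E → ℝ) (x : E) : ‖gradient f x‖ = ‖fderiv ℝ f x‖ := by
  simp [gradient]

theorem loj_E {n : ℕ} {f : EuclideanSpace ℝ (Fin n) → ℝ} {p : EuclideanSpace ℝ (Fin n)}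
    (hf : ∀ x, AnalyticAt ℝ f x) :
    ∃ θ ∈ Set.Ioo (0:ℝ) 1, ∃ c > 0, ∀ᶠ x in 𝓝 p, c * |f x - f p| ^ θ ≤ ‖gradient f x‖ := by
  let e := EuclideanSpace.equiv (Fin n) ℝ
  have hh : AnalyticAt ℝ (fun y => f (e.symm y) - f p) (e p) := by
    apply AnalyticAt.sub _ analyticAt_const
    exact (hf _).comp (e.symm.toContinuousLinearMap.analyticAt _)
  obtain ⟨θ, hθ, c, hc, H⟩ := loj_pi hh (by simp)
  refine ⟨θ, hθ, c / (‖(e.symm : (Fin n → ℝ) →L[ℝ] EuclideanSpace ℝ (Fin n))‖ + 1), by positivity, ?_⟩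
  have H' := e.continuous.continuousAt.eventually H
  filter_upwards [H'] with x hx
  have hx := hx (Set.mem_univ _)
  have hd : fderiv ℝ (fun y => f (e.symm y) - f p) (e x)
      = (fderiv ℝ f x).comp (e.symm : (Fin n → ℝ) →L[ℝ] EuclideanSpace ℝ (Fin n)) := by
    apply HasFDerivAt.fderiv
    apply HasFDerivAt.sub_const
    have h1 : HasFDerivAt f (fderiv ℝ f x) (e.symm (e x)) := by
      rw [e.symm_apply_apply]
      exact (hf x).differentiableAt.hasFDerivAt
    exact h1.comp (e x) e.symm.hasFDerivAt
  rw [hd] at hx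
  simp only [e.symm_apply_apply] at hx
  have h2 := ContinuousLinearMap.opNorm_comp_le (fderiv ℝ f x)
    (e.symm : (Fin n → ℝ) →L[ℝ] EuclideanSpace ℝ (Fin n))
  rw [norm_grad, div_mul_eq_mul_div, div_le_iff₀ (by positivity)]
  nlinarith [norm_nonneg (fderiv ℝ f x)]

end GF

namespace GF

theorem final
    (n : ℕ)
    (f : EuclideanSpace ℝ (Fin n) → ℝ)
    (hf : ∀ x, AnalyticAt ℝ f x)
    (p : EuclideanSpace ℝ (Fin n))
    (hmin : IsLocalMin f p) :
    ∃ U ∈ nhds p, ∃ β : ℝ, β ∈ Set.Ioo (0 : ℝ) 1 ∧ ∃ C : ℝ, 0 < C ∧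
      ∀ γ : ℝ → EuclideanSpace ℝ (Fin n),
        (∀ t : ℝ, 0 ≤ t → HasDerivAt γ (-(gradient f (γ t))) t) →
        γ 0 ∈ U →
        (∃ q : EuclideanSpace ℝ (Fin n), Tendsto γ atTop (nhds q)) ∧
        ∀ t : ℝ, 0 ≤ t →
          (∫⁻ ζ in Set.Ioi t, (‖gradient f (γ ζ)‖₊ : ENNReal))
            ≤ ENNReal.ofReal (C * |f (γ t) - f p| ^ β) := by
  obtain ⟨θ, hθ, c, hc, HL⟩ := loj_E (p := p) hf
  obtain ⟨R, hR, HR⟩ := Metric.eventually_nhds_iff_ball.1 (HL.and hmin)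
  have hfc : Continuous f := continuous_iff_continuousAt.2 fun x => (hf x).continuousAt
  have hgrad : Continuous (gradient f) := by
    have h1 : Continuous (fderiv ℝ f) :=
      continuous_iff_continuousAt.2 fun x => (hf x).fderiv.continuousAt
    exact (InnerProductSpace.toDual ℝ (EuclideanSpace ℝ (Fin n))).symm.continuous.comp h1
  have h1θ : 0 < 1 - θ := by linarith [hθ.2]
  set C : ℝ := 1 / (c * (1 - θ)) with hC
  have hCpos : 0 < C := by positivity
  have hφ : Continuous (fun x => C * |f x - f p| ^ (1 - θ)) := by
    apply Continuous.mul continuous_const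
    exact ((hfc.sub continuous_const).abs).rpow_const fun _ => Or.inr h1θ.le
  have hU : Metric.ball p (R / 2) ∩ {x | C * |f x - f p| ^ (1 - θ) < R / 2} ∈ 𝓝 p := by
    apply Filter.inter_mem (Metric.ball_mem_nhds p (by positivity))
    apply (isOpen_lt hφ continuous_const).mem_nhds
    simp only [Set.mem_ofPred_eq, sub_self, abs_zero]
    rw [Real.zero_rpow h1θ.ne']
    simp only [mul_zero]
    positivity
  refine ⟨_, hU, 1 - θ, ⟨h1θ, by linarith [hθ.1]⟩, C, hCpos, ?_⟩
  intro γ hγ hγ0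
  set δ : ℝ → EuclideanSpace ℝ (Fin n) := fun t => γ (max t 0) with hδ
  have hδe : ∀ t, 0 ≤ t → δ t = γ t := fun t ht => by simp [hδ, max_eq_left ht]
  have hδc : Continuous δ := by
    rw [continuous_iff_continuousAt]
    intro t
    have h2 : ContinuousAt γ (max t 0) := (hγ _ (le_max_right t 0)).continuousAt
    exact ContinuousAt.comp (f := fun s : ℝ => max s 0) h2 (by fun_prop)
  set v : ℝ → ℝ := fun t => ‖gradient f (δ t)‖ with hv
  have hvc : Continuous v := (hgrad.comp hδc).norm
  -- Claim A
  have claimA : ∀ a b : ℝ, 0 ≤ a → a ≤ b → (∀ t ∈ Set.Icc a b, γ t ∈ Metric.ball p R) →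
      ∫ s in a..b, v s ≤ C * |f (γ a) - f p| ^ (1 - θ) := by
    intro a b ha hab hin
    have key : ∀ t ∈ Set.Icc a b, 0 ≤ f (γ t) - f p := fun t ht =>
      sub_nonneg.2 (HR _ (hin t ht)).2
    have := scal (g := fun t => f (γ t) - f p) (v := v) hab hc hθ hvc ?_ key ?_ ?_
    · rw [abs_of_nonneg (key a (Set.left_mem_Icc.2 hab))]
      exact this
    · intro t ht
      have ht0 : 0 ≤ t := ha.trans ht.1
      have h3 := ((hf (γ t)).differentiableAt.hasFDerivAt).comp_hasDerivAt t (hγ t ht0)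
      have h4 : fderiv ℝ f (γ t) (-(gradient f (γ t))) = -(v t) ^ 2 := by
        rw [map_neg, ← toDual_gradient, InnerProductSpace.toDual_apply_apply,
          real_inner_self_eq_norm_sq]
        simp only [hv, hδe t ht0]
      rw [h4] at h3
      exact h3.sub_const _
    · intro t ht hz
      have ht0 : 0 ≤ t := ha.trans ht.1
      have hloc : IsLocalMin f (γ t) := by
        filter_upwards [Metric.isOpen_ball.mem_nhds (hin t ht)] with y hy
        have := (HR y hy).2
        linarith
      simp only [hv, hδe t ht0]
      rw [norm_grad, hloc.fderiv_eq_zero, norm_zero]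
    · intro t ht
      have ht0 : 0 ≤ t := ha.trans ht.1
      have := (HR _ (hin t ht)).1
      rw [abs_of_nonneg (key t ht)] at this
      simpa only [hv, hδe t ht0] using this
  have claimB : ∀ b : ℝ, 0 ≤ b → ‖γ b - γ 0‖ ≤ ∫ s in (0:ℝ)..b, v s := by
    intro b hb
    have h5 : ∫ s in (0:ℝ)..b, -(gradient f (δ s)) = γ b - γ 0 := by
      apply intervalIntegral.integral_eq_sub_of_hasDerivAt
      · intro t ht
        rw [Set.uIcc_of_le hb] at ht
        rw [hδe t ht.1]
        exact hγ t ht.1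
      · exact (hgrad.comp hδc).neg.intervalIntegrable _ _
    rw [← h5]
    refine (intervalIntegral.norm_integral_le_integral_norm hb).trans_eq ?_
    simp only [norm_neg, hv]
  obtain ⟨hγ1, hγ2⟩ := hγ0
  have hγ2 : C * |f (γ 0) - f p| ^ (1 - θ) < R / 2 := hγ2
  have hγ1 : ‖γ 0 - p‖ < R / 2 := mem_ball_iff_norm.1 hγ1
  -- trapping
  have trap : ∀ t : ℝ, 0 ≤ t → γ t ∈ Metric.ball p R := by
    by_contra hcon
    push Not at hcon
    obtain ⟨t', ht', hn'⟩ := hcon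
    set W : Set ℝ := Set.Ici 0 ∩ δ ⁻¹' (Metric.ball p R)ᶜ with hW
    have hWcl : IsClosed W :=
      isClosed_Ici.inter (Metric.isOpen_ball.isClosed_compl.preimage hδc)
    have hWne : W.Nonempty := ⟨t', ht', by simpa [hδe t' ht'] using hn'⟩
    have hWb : BddBelow W := ⟨0, fun x hx => hx.1⟩
    have hm : sInf W ∈ W := hWcl.csInf_mem hWne hWb
    set T := sInf W with hT
    have hT0 : 0 ≤ T := hm.1
    have hTn : γ T ∉ Metric.ball p R := by
      have := hm.2
      rwa [Set.mem_preimage, hδe T hT0] at this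
    have hbefore : ∀ t, 0 ≤ t → t < T → γ t ∈ Metric.ball p R := by
      intro t ht htT
      by_contra h
      have : t ∈ W := ⟨ht, by rw [Set.mem_preimage, hδe t ht]; exact h⟩
      exact absurd (csInf_le hWb this) (not_le.2 htT)
    have hTpos : 0 < T := by
      rcases hT0.lt_or_eq with h | h
      · exact h
      · exfalso
        apply hTn
        rw [← h]
        apply mem_ball_iff_norm.2
        linarith
    have hb : ∀ t, 0 ≤ t → t < T → ‖γ t - γ 0‖ ≤ C * |f (γ 0) - f p| ^ (1 - θ) := by
      intro t ht htT
      exact (claimB t ht).trans (claimA 0 t le_rfl ht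
        (fun s hs => hbefore s hs.1 (hs.2.trans_lt htT)))
    have hlim : Tendsto (fun t => ‖γ t - γ 0‖) (𝓝[<] T) (𝓝 ‖γ T - γ 0‖) := by
      have : ContinuousAt γ T := (hγ T hT0).continuousAt
      have h6 : ContinuousAt (fun t => ‖γ t - γ 0‖) T := by fun_prop
      exact h6.tendsto.mono_left nhdsWithin_le_nhds
    have hle : ‖γ T - γ 0‖ ≤ C * |f (γ 0) - f p| ^ (1 - θ) := by
      apply le_of_tendsto hlim
      filter_upwards [Ioo_mem_nhdsLT hTpos] with t ht
      exact hb t ht.1.le ht.2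
    apply hTn
    apply mem_ball_iff_norm.2
    have : ‖γ T - p‖ ≤ ‖γ T - γ 0‖ + ‖γ 0 - p‖ := norm_sub_le_norm_sub_add_norm_sub _ _ _
    linarith
  have hA : ∀ a b : ℝ, 0 ≤ a → a ≤ b → ∫ s in a..b, v s ≤ C * |f (γ a) - f p| ^ (1 - θ) :=
    fun a b ha hab => claimA a b ha hab fun t ht => trap t (ha.trans ht.1)
  have hIntg : ∀ a : ℝ, 0 ≤ a →
      MeasureTheory.IntegrableOn (fun s => -(gradient f (δ s))) (Set.Ioi a) := by
    intro a ha
    apply MeasureTheory.integrableOn_Ioi_of_intervalIntegral_norm_bounded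
      (C * |f (γ a) - f p| ^ (1 - θ)) a (b := fun i : ℝ => i) (l := atTop)
    · intro i
      exact ((hgrad.comp hδc).neg.integrableOn_Icc (a := a) (b := i)).mono_set
        Set.Ioc_subset_Icc_self
    · exact tendsto_id
    · filter_upwards [eventually_ge_atTop a] with b hb
      have := hA a b ha hb
      simpa only [norm_neg, hv] using this
  refine ⟨⟨limUnder atTop γ, ?_⟩, ?_⟩
  · apply MeasureTheory.tendsto_limUnder_of_hasDerivAt_of_integrableOn_Ioi _ (hIntg 0 le_rfl)
    intro t ht
    have ht0 : 0 ≤ t := le_of_lt ht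
    rw [hδe t ht0]
    exact hγ t ht0
  · intro t ht
    have hvi : MeasureTheory.IntegrableOn v (Set.Ioi t) := by
      have := (hIntg t ht).norm
      simp only [norm_neg] at this
      exact this
    have h7 : ∫ s in Set.Ioi t, v s ≤ C * |f (γ t) - f p| ^ (1 - θ) := by
      apply le_of_tendsto (MeasureTheory.intervalIntegral_tendsto_integral_Ioi t hvi tendsto_id)
      filter_upwards [eventually_ge_atTop t] with b hb
      exact hA t b ht hb
    have h8 : (∫⁻ ζ in Set.Ioi t, (‖gradient f (γ ζ)‖₊ : ENNReal))
        = ∫⁻ ζ in Set.Ioi t, ENNReal.ofReal (v ζ) := by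
      apply MeasureTheory.setLIntegral_congr_fun measurableSet_Ioi
      intro s hs
      have hs0 : 0 ≤ s := ht.trans (le_of_lt hs)
      simp only [hv, hδe s hs0]
      rw [ofReal_norm]
      rfl
    rw [h8, ← MeasureTheory.ofReal_integral_eq_lintegral_ofReal hvi
      (Eventually.of_forall fun s => norm_nonneg _)]
    exact ENNReal.ofReal_le_ofReal h7

end GF

end

/-- Local convergence of gradient flows of an analytic function near a
local minimum, with arclength estimate: there are a neighborhood `U` of `p`,
`β ∈ (0,1)` and `C > 0` such that every gradient flow starting in `U` converges, and
the remaining arclength `∫_t^∞ ‖γ'‖` is at most `C |f(γ t) − f p|^β`. -/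
theorem gradient_flow_convergence_and_length_estimate
    (n : ℕ)
    (f : EuclideanSpace ℝ (Fin n) → ℝ)
    (hf : ∀ x, AnalyticAt ℝ f x)
    (p : EuclideanSpace ℝ (Fin n))
    (hmin : IsLocalMin f p) :
    ∃ U ∈ nhds p, ∃ β : ℝ, β ∈ Set.Ioo (0 : ℝ) 1 ∧ ∃ C : ℝ, 0 < C ∧
      ∀ γ : ℝ → EuclideanSpace ℝ (Fin n),
        (∀ t : ℝ, 0 ≤ t → HasDerivAt γ (-(gradient f (γ t))) t) →
        γ 0 ∈ U →
        (∃ q : EuclideanSpace ℝ (Fin n), Tendsto γ atTop (nhds q)) ∧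
        ∀ t : ℝ, 0 ≤ t →
          (∫⁻ ζ in Set.Ioi t, (‖gradient f (γ ζ)‖₊ : ENNReal))
            ≤ ENNReal.ofReal (C * |f (γ t) - f p| ^ β) := by
  exact GF.final n f hf p hmin
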